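/- arXiv:1105.2599 — 4 statements merged into one kernel-verified Lean document; each statement's English description precedes it below -/
import Mathlib

section
/- Let b be a prime, let s ≥ 1, n ≥ m ≥ 1 be integers, let p(X) ∈ F_b[X] be irreducible with deg(p) = n, let α ≥ 2 be an integer, and let γ = (γ_j)_{j≥1} be positive reals. Let G_{b,n} = {q ∈ F_b[X] \ {0} : deg(q) < n}, and suppose (q_1(X),…,q_s(X)) ∈ G_{b,n}^s is constructed component-by-component, i.e., for each d = 1,…,s the polynomial q_d ∈ G_{b,n} minimizes e_{b^m,α}((q_1,…,q_{d−1}, q), p) over q ∈ G_{b,n}. Then for all d = 1,…,s and all real τ with 1 ≤ τ < α: e_{b^m,α}((q_1,…,q_d), p) ≤ b^{−min(τm, n)} ∏_{j=1}^{d} (1 + 3 γ_j^{1/τ} C_{b,α,τ})^τ, where C_{b,α,τ} = (b−1)^α/(b^{α/τ}−b) · ∏_{i=1}^{α−1} 1/(b^{i/τ}−1) + (α−1) if τ = 1, and C_{b,α,τ} = (b−1)^α/(b^{α/τ}−b) · ∏_{i=1}^{α−1} 1/(b^{i/τ}−1) + (b−1)((b−1)^{α−1}−(b^{1/τ}−1)^{α−1})/((b−b^{1/τ})(b^{1/τ}−1)^{α−1})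 if τ > 1. -/
open scoped BigOperators
open scoped Classical

noncomputable section

/-- The `i`-th base-`b` digit (for `i ≥ 1`) of a real `x` (intended `x ∈ [0,1)`),
using the expansion that does not end in infinitely many digits `b-1`. -/
def xdigit (b : ℕ) (x : ℝ) (i : ℕ) : ℕ := (⌊x * (b : ℝ) ^ i⌋).toNat % b

/-- The `i`-th base-`b` digit of a natural number `k`. -/
def ndigit (b k i : ℕ) : ℕ := k / b ^ i % b

/-- The `k`-th Walsh function in base `b`:
`wal_k(x) = exp(2πi (ξ_1 κ_0 + ξ_2 κ_1 + ⋯)/b)`. -/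
def wal (b k : ℕ) (x : ℝ) : ℂ :=
  Complex.exp (2 * (Real.pi : ℂ) * Complex.I / (b : ℂ) *
    ∑ i ∈ Finset.range (k + 1), (ndigit b k i : ℂ) * (xdigit b x (i + 1) : ℂ))

/-- The set of positions of nonzero base-`b` digits of `k`. -/
def nzset (b k : ℕ) : Finset ℕ :=
  (Finset.range (k + 1)).filter fun i => ndigit b k i ≠ 0

/-- The (at most) `α` largest nonzero-digit positions of `k` in base `b`. -/
def topPos (b α k : ℕ) : Finset ℕ :=
  (nzset b k).filter fun a => ((nzset b k).filter fun y => a < y).card < α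

/-- `r_α(k) = b^{-∑_{i=1}^{min(#k,α)} (a_i + 1)}`, where `a_1 > a_2 > ⋯` are the positions of
the nonzero base-`b` digits of `k`; `r_α(0) = 1`. -/
def ralpha (b α k : ℕ) : ℝ := ((b : ℝ) ^ (∑ a ∈ topPos b α k, (a + 1)))⁻¹

/-- `r_α(γ, k) = ∏_{j : k_j ≠ 0} γ_j r_α(k_j)` (weights indexed from `0`). -/
def rvec (b α : ℕ) (γ : ℕ → ℝ) {s : ℕ} (k : Fin s → ℕ) : ℝ :=
  ∏ j, if k j = 0 then 1 else γ (j : ℕ) * ralpha b α (k j)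

/-- `ω_α(x) = ∑_{k=1}^∞ r_α(k) wal_k(x)`. -/
def omegaF (b α : ℕ) (x : ℝ) : ℂ :=
  ∑' k : ℕ, (ralpha b α (k + 1) : ℂ) * wal b (k + 1) x

/-- The polynomial over `F_b` whose coefficients are the base-`b` digits of `h`. -/
def natPoly (b : ℕ) (h : ℕ) : Polynomial (ZMod b) :=
  ∑ i ∈ Finset.range (h + 1), Polynomial.C ((ndigit b h i : ℕ) : ZMod b) * Polynomial.X ^ i

/-- The coefficient of `X^{-i}` (for `i ≥ 1`) in the Laurent series expansion of `w/p`
in `F_b((X^{-1}))` (the negative-power part of `w/p`). -/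
def laurentCoeff (b : ℕ) [Fact (Nat.Prime b)] (p w : Polynomial (ZMod b)) (i : ℕ) : ZMod b :=
  p.leadingCoeff⁻¹ * (Polynomial.X ^ (i - 1) * w % p).coeff (p.natDegree - 1)

/-- `v_n(w/p) = ∑_{i=1}^n u_i b^{-i}` where `u_i` are the Laurent coefficients of `w/p`. -/
def vn (b : ℕ) [Fact (Nat.Prime b)] (n : ℕ) (p w : Polynomial (ZMod b)) : ℝ :=
  ∑ i ∈ Finset.range n, ((laurentCoeff b p w (i + 1)).val : ℝ) / (b : ℝ) ^ (i + 1)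

/-- Membership of `k ∈ ℕ₀^s` in the dual polynomial lattice:
`∑_j k_j(X) q_j(X) ≡ a(X) (mod p(X))` for some `a` with `deg(a) < n - m`. -/
def inDual (b : ℕ) (n m : ℕ) {s : ℕ} (p : Polynomial (ZMod b))
    (q : Fin s → Polynomial (ZMod b)) (k : Fin s → ℕ) : Prop :=
  ∃ a : Polynomial (ZMod b), a.degree < ((n - m : ℕ) : WithBot ℕ) ∧
    p ∣ ((∑ j, natPoly b (k j) * q j) - a)

/-- The worst-case error `e_{b^m,α}(q, p) = ∑_{0 ≠ k ∈ D} r_α(γ,k)`. -/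
def wce (b : ℕ) [Fact (Nat.Prime b)] (n m α : ℕ) (γ : ℕ → ℝ) {s : ℕ}
    (p : Polynomial (ZMod b)) (q : Fin s → Polynomial (ZMod b)) : ℝ :=
  ∑' k : Fin s → ℕ, if k ≠ 0 ∧ inDual b n m p q k then rvec b α γ k else 0

/-- The constant `C_{b,α,τ}`. -/
def Cbat (b α : ℕ) (τ : ℝ) : ℝ :=
  ((b : ℝ) - 1) ^ α / ((b : ℝ) ^ ((α : ℝ) / τ) - b) *
      ∏ i ∈ Finset.range (α - 1), ((b : ℝ) ^ (((i : ℝ) + 1) / τ) - 1)⁻¹ +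
    if τ = 1 then (α : ℝ) - 1
    else ((b : ℝ) - 1) * (((b : ℝ) - 1) ^ (α - 1) - ((b : ℝ) ^ (1 / τ) - 1) ^ (α - 1)) /
      (((b : ℝ) - (b : ℝ) ^ (1 / τ)) * ((b : ℝ) ^ (1 / τ) - 1) ^ (α - 1))

/-- The exponent `∑_{i=1}^{min(#k,α)} (a_i + 1)` of `b⁻¹` in `r_α(k)`. -/
def topExp (b α k : ℕ) : ℕ := ∑ a ∈ topPos b α k, (a + 1)

section Digits

variable {b : ℕ}

lemma mem_nzset (hb : 1 < b) {k i : ℕ} : i ∈ nzset b k ↔ ndigit b k i ≠ 0 := by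
  simp only [nzset, Finset.mem_filter, Finset.mem_range, and_iff_right_iff_imp]
  intro h
  by_contra! hi
  apply h
  rw [ndigit, Nat.div_eq_of_lt, Nat.zero_mod]
  exact (by omega : k < i).trans (Nat.lt_pow_self hb)

lemma ndigit_mul_add_zero {κ : ℕ} (hκ : κ < b) (k : ℕ) : ndigit b (b * k + κ) 0 = κ := by
  simp [ndigit, Nat.mod_eq_of_lt hκ]

lemma ndigit_mul_add_succ {κ : ℕ} (hκ : κ < b) (k i : ℕ) :
    ndigit b (b * k + κ) (i + 1) = ndigit b k i := by
  rw [ndigit, ndigit, pow_succ', ← Nat.div_div_eq_div_mul, Nat.mul_add_div (by omega),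
    Nat.div_eq_of_lt hκ, add_zero]

lemma card_filter_nzset_succ (hb : 1 < b) {κ : ℕ} (hκ : κ < b) (k i : ℕ) :
    ((nzset b (b * k + κ)).filter fun y => i + 1 < y).card =
      ((nzset b k).filter fun y => i < y).card := by
  rw [← Finset.card_image_of_injective ((nzset b k).filter fun y => i < y) Nat.succ_injective]
  congr 1
  ext y
  cases y with
  | zero => simp
  | succ y => simp [mem_nzset hb, ndigit_mul_add_succ hκ]

lemma card_filter_nzset_zero (hb : 1 < b) {κ : ℕ} (hκ : κ < b) (k : ℕ) :
    ((nzset b (b * k + κ)).filter fun y => 0 < y).card = (nzset b k).card := by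
  rw [← Finset.card_image_of_injective (nzset b k) Nat.succ_injective]
  congr 1
  ext y
  cases y with
  | zero => simp
  | succ y => simp [mem_nzset hb, ndigit_mul_add_succ hκ]

lemma card_nzset_mul_add (hb : 1 < b) {κ : ℕ} (hκ : κ < b) (k : ℕ) :
    (nzset b (b * k + κ)).card = (nzset b k).card + if κ = 0 then 0 else 1 := by
  rw [← card_filter_nzset_zero hb hκ k]
  split_ifs with h
  · rw [add_zero, Finset.filter_true_of_mem]
    intro y hy
    rw [mem_nzset hb] at hy
    rcases Nat.eq_zero_or_pos y with rfl | h'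
    · exact absurd (by rw [ndigit_mul_add_zero hκ, h]) hy
    · exact h'
  · rw [← Finset.card_insert_of_notMem (a := 0) (by simp)]
    congr 1
    ext y
    rcases Nat.eq_zero_or_pos y with rfl | h'
    · simp [mem_nzset hb, ndigit_mul_add_zero hκ, h]
    · simp [h', h'.ne']

lemma topPos_mul_add (hb : 1 < b) {κ : ℕ} (hκ : κ < b) (α k : ℕ) :
    topPos b α (b * k + κ) = (if κ ≠ 0 ∧ (nzset b k).card < α then {0} else ∅) ∪
      (topPos b α k).map ⟨Nat.succ, Nat.succ_injective⟩ := by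
  ext y
  cases y with
  | zero =>
    simp only [topPos, Finset.mem_filter, mem_nzset hb, ndigit_mul_add_zero hκ,
      card_filter_nzset_zero hb hκ]
    split_ifs with h <;> simp [h]
  | succ y =>
    simp only [topPos, Finset.mem_filter, mem_nzset hb, ndigit_mul_add_succ hκ,
      card_filter_nzset_succ hb hκ]
    split_ifs with h <;> simp [mem_nzset hb]

lemma sum_topPos_mul_add (hb : 1 < b) {κ : ℕ} (hκ : κ < b) (α k : ℕ) (f : ℕ → ℕ) :
    ∑ a ∈ topPos b α (b * k + κ), f a =
      (if κ ≠ 0 ∧ (nzset b k).card < α then f 0 else 0) + ∑ a ∈ topPos b α k, f (a + 1) := by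
  rw [topPos_mul_add hb hκ, Finset.sum_union, Finset.sum_map]
  · split_ifs <;> simp
  · split_ifs <;> simp

lemma nzset_zero (b : ℕ) : nzset b 0 = ∅ := by
  simp [nzset, ndigit]

lemma topPos_zero (b α : ℕ) : topPos b α 0 = ∅ := by
  simp [topPos, nzset_zero]

lemma card_nzset_pos (hb : 1 < b) {k : ℕ} (hk : k ≠ 0) : 0 < (nzset b k).card := by
  refine Finset.card_pos.2 ⟨Nat.log b k, (mem_nzset hb).2 ?_⟩
  have h1 : b ^ Nat.log b k ≤ k := Nat.pow_log_le_self b hk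
  have h2 : k < b ^ (Nat.log b k + 1) := Nat.lt_pow_succ_log_self hb k
  rw [ndigit, Nat.mod_eq_of_lt]
  · exact (Nat.div_pos h1 (by positivity)).ne'
  · rwa [Nat.div_lt_iff_lt_mul (by positivity), ← pow_succ']

lemma card_topPos (hb : 1 < b) (α k : ℕ) :
    (topPos b α k).card = min (nzset b k).card α := by
  induction k using Nat.strong_induction_on with
  | _ k ih =>
    rcases Nat.eq_zero_or_pos k with rfl | hk
    · simp [topPos_zero, nzset_zero]
    · have hlt : k % b < b := Nat.mod_lt _ (by omega)
      have ih' := ih _ (Nat.div_lt_self hk hb)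
      rw [Finset.card_eq_sum_ones] at ih' ⊢
      conv_lhs => rw [← Nat.div_add_mod k b]
      conv_rhs => rw [← Nat.div_add_mod k b]
      rw [sum_topPos_mul_add hb hlt, card_nzset_mul_add hb hlt, ih']
      split_ifs <;> omega

lemma topExp_mul_add (hb : 1 < b) {κ : ℕ} (hκ : κ < b) (α k : ℕ) :
    topExp b α (b * k + κ) = topExp b α k + min (nzset b k).card α +
      if κ ≠ 0 ∧ (nzset b k).card < α then 1 else 0 := by
  rw [topExp, topExp, sum_topPos_mul_add hb hκ, ← card_topPos hb,
    Finset.card_eq_sum_ones (topPos b α k),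
    ← Finset.sum_add_distrib, add_comm]

lemma ralpha_eq (b α k : ℕ) : ralpha b α k = ((b : ℝ) ^ topExp b α k)⁻¹ := rfl

lemma ralpha_nonneg (b α k : ℕ) : 0 ≤ ralpha b α k := by
  unfold ralpha; positivity

/-- Removing the `n` lowest digits of `k ≥ b^n` shifts every leading nonzero digit down by `n`. -/
lemma topExp_div_pow_add_le (hb : 1 < b) {α : ℕ} (hα : 1 ≤ α) (n : ℕ) :
    ∀ k, k / b ^ n ≠ 0 → topExp b α (k / b ^ n) + n ≤ topExp b α k := by
  induction n with
  | zero => simp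
  | succ n ih =>
    intro k hk
    rw [pow_succ', ← Nat.div_div_eq_div_mul] at hk ⊢
    have hk' : k / b ≠ 0 := fun h => hk (by simp [h])
    have h1 := ih _ hk
    have h2 := topExp_mul_add hb (Nat.mod_lt k (by omega : b > 0)) α (k / b)
    rw [Nat.div_add_mod] at h2
    have h3 := card_nzset_pos hb hk'
    have h4 : 1 ≤ min (nzset b (k / b)).card α := le_min h3 hα
    omega

end Digits

section DigitSums

lemma sum_range_mul_eq {M : Type*} [AddCommMonoid M] (b N : ℕ) (f : ℕ → M) :
    ∑ k ∈ Finset.range (b * N), f k =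
      ∑ k ∈ Finset.range N, ∑ κ ∈ Finset.range b, f (b * k + κ) := by
  induction N with
  | zero => simp
  | succ N ih => rw [mul_add, mul_one, Finset.sum_range_add, ih, Finset.sum_range_succ]

/-- The sum of `x ^ topExp b α k` over the `k < b^N` with `min(#k, α) = v`. -/
def classSum (b α : ℕ) (x : ℝ) (v N : ℕ) : ℝ :=
  ∑ k ∈ Finset.range (b ^ N), if min (nzset b k).card α = v then x ^ topExp b α k else 0

variable {b α : ℕ}

lemma classSum_zero_right (x : ℝ) (v : ℕ) :
    classSum b α x v 0 = if v = 0 then 1 else 0 := by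
  simp [classSum, nzset_zero, topExp, topPos_zero, eq_comm]

lemma classSum_zero_left (hb : 1 < b) (hα : 1 ≤ α) (x : ℝ) (N : ℕ) :
    classSum b α x 0 N = 1 := by
  rw [classSum, Finset.sum_eq_single 0]
  · simp [nzset_zero, topExp, topPos_zero]
  · intro k _ hk
    have := card_nzset_pos hb hk
    rw [if_neg (by omega)]
  · simp; omega

lemma sum_last_digit (hb : 1 < b) (x : ℝ) {v : ℕ} (hv : v + 1 ≤ α) (k : ℕ) :
    (∑ κ ∈ Finset.range b, if min (nzset b (b * k + κ)).card α = v + 1 then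
        x ^ topExp b α (b * k + κ) else 0) =
      (if v + 1 = α then (b : ℝ) else 1) * x ^ (v + 1) *
          (if min (nzset b k).card α = v + 1 then x ^ topExp b α k else 0) +
        ((b : ℝ) - 1) * x ^ (v + 1) *
          (if min (nzset b k).card α = v then x ^ topExp b α k else 0) := by
  have key : ∀ κ ∈ Finset.range b, (if min (nzset b (b * k + κ)).card α = v + 1 then
        x ^ topExp b α (b * k + κ) else 0) =
      if min ((nzset b k).card + if κ = 0 then 0 else 1) α = v + 1 then
        x ^ (topExp b α k + min (nzset b k).card α +
          if κ ≠ 0 ∧ (nzset b k).card < α then 1 else 0) else 0 := by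
    intro κ hκ
    rw [Finset.mem_range] at hκ
    rw [card_nzset_mul_add hb hκ, topExp_mul_add hb hκ]
  rw [Finset.sum_congr rfl key]
  generalize (nzset b k).card = c
  generalize topExp b α k = e
  obtain ⟨b, rfl⟩ : ∃ b', b = b' + 1 := ⟨b - 1, by omega⟩
  rw [Finset.sum_range_succ']
  simp only [Nat.add_eq_zero_iff, one_ne_zero, and_false, if_false, ne_eq, not_false_eq_true,
    true_and, not_true_eq_false, false_and, if_true, add_zero, Finset.sum_const,
    Finset.card_range, nsmul_eq_mul, Nat.cast_add, Nat.cast_one, add_sub_cancel_right]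
  rcases lt_trichotomy c v with h | rfl | h
  · have h1 : min (c + 1) α ≠ v + 1 := by omega
    have h2 : min c α ≠ v + 1 := by omega
    have h3 : min c α ≠ v := by omega
    simp only [h1, h2, h3, if_false]
    simp
  · have h1 : min (c + 1) α = c + 1 := by omega
    have h2 : min c α = c := by omega
    have h3 : c < α := by omega
    have h4 : c ≠ c + 1 := by omega
    simp only [h1, h2, h3, h4, if_true, if_false]
    ring
  · have h3 : min c α ≠ v := by omega
    by_cases hvα : v + 1 = α
    · have h1 : min (c + 1) α = v + 1 := by omega
      have h2 : min c α = v + 1 := by omega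
      have h4 : ¬ c < α := by omega
      have h5 : α ≠ v := by omega
      simp only [h1, h2, h4, h5, hvα, if_true, if_false]
      ring
    · have h1 : min (c + 1) α ≠ v + 1 := by omega
      by_cases hc : c = v + 1
      · have h2 : min c α = v + 1 := by omega
        have h5 : v + 1 ≠ v := by omega
        simp only [h1, h2, h5, hvα, if_true, if_false]
        ring
      · have h2 : min c α ≠ v + 1 := by omega
        simp only [h1, h2, h3, if_false]
        simp

lemma classSum_succ_succ (hb : 1 < b) (x : ℝ) {v : ℕ} (hv : v + 1 ≤ α) (N : ℕ) :
    classSum b α x (v + 1) (N + 1) =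
      (if v + 1 = α then (b : ℝ) else 1) * x ^ (v + 1) * classSum b α x (v + 1) N +
        ((b : ℝ) - 1) * x ^ (v + 1) * classSum b α x v N := by
  simp only [classSum]
  rw [pow_succ', sum_range_mul_eq, Finset.sum_congr rfl fun k _ => sum_last_digit hb x hv k,
    Finset.sum_add_distrib, Finset.mul_sum, Finset.mul_sum]

lemma classSum_succ_le (hb : 1 < b) {z : ℝ} (hz : 0 < z) {v : ℕ} (hv : v + 1 ≤ α)
    (ht : (if v + 1 = α then (b : ℝ) else 1) < z ^ (v + 1)) {B : ℝ}
    (hB : ∀ N, classSum b α z⁻¹ v N ≤ B) (N : ℕ) :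
    classSum b α z⁻¹ (v + 1) N ≤
      ((b : ℝ) - 1) * B / (z ^ (v + 1) - if v + 1 = α then (b : ℝ) else 1) := by
  have hb' : (1 : ℝ) < b := by exact_mod_cast hb
  have ht0 : 0 ≤ (if v + 1 = α then (b : ℝ) else 1) := by split_ifs <;> positivity
  have hB0 : 0 ≤ B := le_trans (Finset.sum_nonneg fun k _ => by positivity) (hB 0)
  generalize hT : (if v + 1 = α then (b : ℝ) else 1) = T at ht ht0 ⊢
  have hd : 0 < z ^ (v + 1) - T := by linarith
  induction N with
  | zero =>
    rw [classSum_zero_right, if_neg (by omega)]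
    exact div_nonneg (mul_nonneg (by linarith) hB0) hd.le
  | succ N ih =>
    rw [classSum_succ_succ hb _ hv, hT]
    have hx : 0 < z⁻¹ ^ (v + 1) := by positivity
    have hb0 : 0 ≤ (b : ℝ) - 1 := by linarith
    calc _ ≤ T * z⁻¹ ^ (v + 1) * (((b : ℝ) - 1) * B / (z ^ (v + 1) - T)) +
          ((b : ℝ) - 1) * z⁻¹ ^ (v + 1) * B := by
          gcongr
          exact hB N
      _ = _ := by
          rw [inv_pow]
          have hz' : z ^ (v + 1) ≠ 0 := by positivity
          field_simp
          ring

lemma classSum_le_prod (hb : 1 < b) {z : ℝ} (hz : 1 < z) {v : ℕ} (hv : v < α) (N : ℕ) :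
    classSum b α z⁻¹ v N ≤
      ((b : ℝ) - 1) ^ v * ∏ i ∈ Finset.range v, (z ^ (i + 1) - 1)⁻¹ := by
  induction v generalizing N with
  | zero => simp [classSum_zero_left hb hv]
  | succ v ih =>
    have h1 : ¬ v + 1 = α := by omega
    have := classSum_succ_le hb (by linarith) hv.le
      (by rw [if_neg h1]; exact one_lt_pow₀ hz (by omega)) (ih (by omega)) N
    rw [if_neg h1] at this
    refine this.trans_eq ?_
    rw [Finset.prod_range_succ]
    ring

lemma classSum_top_le (hb : 1 < b) {z : ℝ} (hz : 1 < z) (hα : 1 ≤ α) (hzα : (b : ℝ) < z ^ α)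
    (N : ℕ) : classSum b α z⁻¹ α N ≤
      ((b : ℝ) - 1) ^ α / (z ^ α - b) * ∏ i ∈ Finset.range (α - 1), (z ^ (i + 1) - 1)⁻¹ := by
  obtain ⟨a, rfl⟩ : ∃ a, α = a + 1 := ⟨α - 1, by omega⟩
  have := classSum_succ_le (v := a) hb (by linarith) le_rfl (by simpa using hzα)
    (classSum_le_prod hb hz (by omega)) N
  refine this.trans_eq ?_
  simp only [if_true, add_tsub_cancel_right]
  ring

lemma classSum_le_pow (hb : 1 < b) {z : ℝ} (hz : 1 < z) {v : ℕ} (hv : v < α) (N : ℕ) :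
    classSum b α z⁻¹ v N ≤ (((b : ℝ) - 1) / (z - 1)) ^ v := by
  have hb' : (1 : ℝ) < b := by exact_mod_cast hb
  refine (classSum_le_prod hb hz hv N).trans ?_
  rw [div_pow, div_eq_mul_inv, ← inv_pow]
  have hb0 : 0 ≤ (b : ℝ) - 1 := by linarith
  gcongr
  · refine (Finset.prod_le_prod (g := fun _ => (z - 1)⁻¹) ?_ ?_).trans_eq (by simp)
    · intro i _
      have := one_lt_pow₀ hz (n := i + 1) (by omega)
      exact inv_nonneg.2 (by linarith)
    · intro i _
      have := le_self_pow₀ hz.le (n := i + 1) (by omega)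
      exact inv_anti₀ (by linarith) (by linarith)

lemma sum_classSum (x : ℝ) (N : ℕ) :
    ∑ v ∈ Finset.range (α + 1), classSum b α x v N =
      ∑ k ∈ Finset.range (b ^ N), x ^ topExp b α k := by
  simp only [classSum]
  rw [Finset.sum_comm]
  refine Finset.sum_congr rfl fun k _ => ?_
  rw [Finset.sum_ite_eq, if_pos]
  simp

/-- The sum of `r_α(k)^{1/τ}` over finitely many `k ≥ 1` is at most `C_{b,α,τ}`. -/
lemma sum_ralpha_rpow_le (hb : 1 < b) (hα : 2 ≤ α) {τ : ℝ} (hτ : 1 ≤ τ) (hτα : τ < α) (M : ℕ) :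
    ∑ k ∈ Finset.range M, ralpha b α (k + 1) ^ (1 / τ) ≤ Cbat b α τ := by
  have hb' : (1 : ℝ) < b := by exact_mod_cast hb
  have hτ0 : 0 < τ := by linarith
  set z : ℝ := (b : ℝ) ^ (1 / τ) with hz
  have hz1 : 1 < z := Real.one_lt_rpow hb' (by positivity)
  have hzpow : ∀ i : ℕ, z ^ i = (b : ℝ) ^ ((i : ℝ) / τ) := by
    intro i
    rw [hz, ← Real.rpow_mul_natCast (by positivity)]
    congr 1
    ring
  have hzα : (b : ℝ) < z ^ α := by
    rw [hzpow]
    exact Real.self_lt_rpow_of_one_lt hb' ((one_lt_div hτ0).2 hτα)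
  have hr : ∀ k, ralpha b α k ^ (1 / τ) = z⁻¹ ^ topExp b α k := by
    intro k
    rw [ralpha_eq, Real.inv_rpow (by positivity), inv_pow, hzpow, ← Real.rpow_natCast,
      ← Real.rpow_mul (by positivity)]
    congr 2
    ring
  have h1 : 1 + ∑ k ∈ Finset.range M, ralpha b α (k + 1) ^ (1 / τ) ≤
      ∑ v ∈ Finset.range (α + 1), classSum b α z⁻¹ v (M + 1) := by
    rw [sum_classSum]
    simp only [hr]
    have : (1 : ℝ) = z⁻¹ ^ topExp b α 0 := by simp [topExp, topPos_zero]
    rw [this, add_comm, ← Finset.sum_range_succ' (fun k => z⁻¹ ^ topExp b α k)]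
    refine Finset.sum_le_sum_of_subset_of_nonneg ?_ fun k _ _ => by positivity
    exact Finset.range_subset_range.2 (Nat.lt_pow_self hb).le
  have h2 : ∑ v ∈ Finset.range (α + 1), classSum b α z⁻¹ v (M + 1) ≤
      1 + ∑ v ∈ Finset.range (α - 1), (((b : ℝ) - 1) / (z - 1)) ^ (v + 1) +
        ((b : ℝ) - 1) ^ α / (z ^ α - b) *
          ∏ i ∈ Finset.range (α - 1), (z ^ (i + 1) - 1)⁻¹ := by
    rw [Finset.sum_range_succ]
    refine add_le_add ?_ (classSum_top_le hb hz1 (by omega) hzα _)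
    obtain ⟨a, rfl⟩ : ∃ a, α = a + 1 := ⟨α - 1, by omega⟩
    rw [Finset.sum_range_succ', classSum_zero_left hb (by omega), add_comm]
    refine add_le_add_right (Finset.sum_le_sum fun v hv => ?_) _
    simp only [Finset.mem_range] at hv
    exact classSum_le_pow hb hz1 (by omega) _
  have h3 : Cbat b α τ = ((b : ℝ) - 1) ^ α / (z ^ α - b) *
        ∏ i ∈ Finset.range (α - 1), (z ^ (i + 1) - 1)⁻¹ +
      ∑ v ∈ Finset.range (α - 1), (((b : ℝ) - 1) / (z - 1)) ^ (v + 1) := by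
    rw [Cbat]
    simp only [hzpow, Nat.cast_add, Nat.cast_one]
    congr 1
    split_ifs with h
    · have : z = b := by simp [hz, h]
      rw [this, div_self (by linarith)]
      simp [Nat.cast_sub (by omega : 1 ≤ α)]
    · have hzb : z < b := by
        rw [hz]
        exact Real.rpow_lt_self_of_one_lt hb' (by
          rw [div_lt_one hτ0]; exact lt_of_le_of_ne hτ (Ne.symm h))
      have hz0 : z - 1 ≠ 0 := by linarith
      have hbz : (b : ℝ) - z ≠ 0 := by linarith
      have hy : ((b : ℝ) - 1) / (z - 1) ≠ 1 := by
        rw [Ne, div_eq_one_iff_eq hz0]; intro h'; linarith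
      simp only [pow_succ]
      rw [← Finset.sum_mul, geom_sum_eq hy, div_pow]
      have h4 : ((b : ℝ) - 1) / (z - 1) - 1 = (b - z) / (z - 1) := by
        field_simp; ring
      rw [h4, ← hz]
      field_simp
  linarith

end DigitSums

section DigitPolynomials

variable {b : ℕ}

lemma coeff_natPoly (hb : 1 < b) (k i : ℕ) :
    (natPoly b k).coeff i = ((ndigit b k i : ℕ) : ZMod b) := by
  simp only [natPoly, Polynomial.finsetSum_coeff, Polynomial.coeff_C_mul_X_pow]
  rw [Finset.sum_ite_eq]
  split_ifs with h
  · rfl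
  · have : ndigit b k i = 0 := by
      by_contra h'
      have := (mem_nzset hb).2 h'
      exact h (Finset.mem_of_mem_filter _ this)
    simp [this]

lemma natPoly_zero (b : ℕ) : natPoly b 0 = 0 := by
  simp [natPoly, ndigit]

lemma natPoly_injective (hb : 1 < b) : Function.Injective (natPoly b) := by
  intro k l h
  have hd : ∀ i, ndigit b k i = ndigit b l i := by
    intro i
    have := congrArg (fun f => Polynomial.coeff f i) h
    simp only [coeff_natPoly hb] at this
    rw [ZMod.natCast_eq_natCast_iff', ndigit, ndigit, Nat.mod_mod, Nat.mod_mod] at this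
    exact this
  have hmod : ∀ N, k % b ^ N = l % b ^ N := by
    intro N
    induction N with
    | zero => simp [Nat.mod_one]
    | succ N ih =>
      have := hd N
      rw [ndigit, ndigit] at this
      rw [Nat.mod_pow_succ, Nat.mod_pow_succ, ih, this]
  have hlt : max k l < b ^ max k l := Nat.lt_pow_self hb
  have := hmod (max k l)
  rwa [Nat.mod_eq_of_lt (by omega), Nat.mod_eq_of_lt (by omega)] at this

lemma natPoly_ne_zero (hb : 1 < b) {k : ℕ} (hk : k ≠ 0) : natPoly b k ≠ 0 := fun h =>
  hk (natPoly_injective hb (h.trans (natPoly_zero b).symm))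

lemma degree_natPoly_lt (hb : 1 < b) {k n : ℕ} (hk : k < b ^ n) :
    (natPoly b k).degree < (n : WithBot ℕ) := by
  rw [Polynomial.degree_lt_iff_coeff_zero]
  intro i hi
  rw [coeff_natPoly hb, ndigit, Nat.div_eq_of_lt, Nat.zero_mod, Nat.cast_zero]
  exact hk.trans_le (Nat.pow_le_pow_right (by omega) hi)

lemma degree_natPoly_sub_lt (hb : 1 < b) {k l n : ℕ} (h : k / b ^ n = l / b ^ n) :
    (natPoly b k - natPoly b l).degree < (n : WithBot ℕ) := by
  rw [Polynomial.degree_lt_iff_coeff_zero]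
  intro i hi
  obtain ⟨j, rfl⟩ := Nat.exists_eq_add_of_le hi
  rw [Polynomial.coeff_sub, coeff_natPoly hb, coeff_natPoly hb, ndigit, ndigit, pow_add,
    ← Nat.div_div_eq_div_mul, ← Nat.div_div_eq_div_mul, h, sub_self]

variable [Fact (Nat.Prime b)] {n m : ℕ} {p : Polynomial (ZMod b)}

lemma eq_zero_of_dvd_of_degree_lt (hdeg : p.natDegree = n) {f : Polynomial (ZMod b)}
    (hpf : p ∣ f) (hf : f.degree < (n : WithBot ℕ)) : f = 0 := by
  by_contra h0
  have h1 := Polynomial.natDegree_le_of_dvd hpf h0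
  rw [← Polynomial.natDegree_lt_iff_degree_lt h0] at hf
  omega

lemma eq_of_dvd_of_div_pow_eq (hb : 1 < b) (hdeg : p.natDegree = n) {k l : ℕ}
    (hk : p ∣ natPoly b k) (hl : p ∣ natPoly b l) (h : k / b ^ n = l / b ^ n) : k = l :=
  natPoly_injective hb <| sub_eq_zero.1 <|
    eq_zero_of_dvd_of_degree_lt hdeg (dvd_sub hk hl) (degree_natPoly_sub_lt hb h)

/-- If `p ∤ K`, at most `b^{n-m}` polynomials `q` of degree less than `n` satisfy
`A + K q ≡ a (mod p)` for some `a` with `deg a < n - m`. -/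
lemma card_filter_congr_le (hp : Irreducible p) (hdeg : p.natDegree = n)
    (A K : Polynomial (ZMod b)) (hK : ¬ p ∣ K) (s : Finset ℕ) (hs : ∀ h ∈ s, h < b ^ n) :
    (s.filter fun h => ∃ a : Polynomial (ZMod b), a.degree < ((n - m : ℕ) : WithBot ℕ) ∧
      p ∣ A + K * natPoly b h - a).card ≤ b ^ (n - m) := by
  have hb : 1 < b := (Fact.out : Nat.Prime b).one_lt
  have hex : ∀ h : ℕ, ∃ a : Polynomial (ZMod b),
      (∃ a : Polynomial (ZMod b), a.degree < ((n - m : ℕ) : WithBot ℕ) ∧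
        p ∣ A + K * natPoly b h - a) →
      a.degree < ((n - m : ℕ) : WithBot ℕ) ∧ p ∣ A + K * natPoly b h - a := by
    intro h
    by_cases hh : ∃ a : Polynomial (ZMod b), a.degree < ((n - m : ℕ) : WithBot ℕ) ∧
        p ∣ A + K * natPoly b h - a
    · obtain ⟨a, ha⟩ := hh
      exact ⟨a, fun _ => ha⟩
    · exact ⟨0, fun h' => absurd h' hh⟩
  choose a ha using hex
  have hcard : (Finset.univ : Finset (Fin (n - m) → ZMod b)).card = b ^ (n - m) := by
    simp [ZMod.card]
  rw [← hcard]
  refine Finset.card_le_card_of_injOn (fun h i => (a h).coeff i) (fun _ _ => by simp) ?_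
  intro h hh h' hh' heq
  simp only [Finset.coe_filter, Set.mem_ofPred_eq] at hh hh'
  obtain ⟨hd, hdvd⟩ := ha h hh.2
  obtain ⟨hd', hdvd'⟩ := ha h' hh'.2
  have haa : a h = a h' := by
    ext i
    by_cases hi : i < n - m
    · exact congrFun heq ⟨i, hi⟩
    · rw [Polynomial.degree_lt_iff_coeff_zero] at hd hd'
      rw [hd i (by omega), hd' i (by omega)]
  rw [← haa] at hdvd'
  have h1 : p ∣ K * (natPoly b h - natPoly b h') := by
    have := dvd_sub hdvd hdvd'
    convert this using 1
    ring
  have h2 := (hp.prime.dvd_or_dvd h1).resolve_left hK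
  refine natPoly_injective hb (sub_eq_zero.1 (eq_zero_of_dvd_of_degree_lt hdeg h2 ?_))
  refine degree_natPoly_sub_lt hb ?_
  rw [Nat.div_eq_of_lt (hs h hh.1), Nat.div_eq_of_lt (hs h' hh'.1)]

end DigitPolynomials

section ExtendedSums

open scoped ENNReal

lemma ENNReal.tsum_rpow_le_tsum_rpow {ι : Type*} (f : ι → ℝ≥0∞) {t : ℝ} (ht : 0 < t)
    (ht1 : t ≤ 1) : (∑' i, f i) ^ t ≤ ∑' i, f i ^ t := by
  rw [← ENNReal.le_rpow_inv_iff ht, ENNReal.tsum_eq_iSup_sum]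
  refine iSup_le fun s => ?_
  rw [ENNReal.le_rpow_inv_iff ht]
  refine le_trans ?_ (ENNReal.sum_le_tsum s)
  exact Finset.le_sum_of_subadditive (fun x : ℝ≥0∞ => x ^ t) (ENNReal.zero_rpow_of_pos ht).le
    (fun x y => ENNReal.rpow_add_le_add_rpow x y ht.le ht1) s f

lemma ENNReal.tsum_fin_succ {d : ℕ} (F : (Fin (d + 1) → ℕ) → ℝ≥0∞) :
    ∑' k, F k = ∑' k : Fin d → ℕ, F (Fin.snoc k 0) +
      ∑' (l : ℕ) (k : Fin d → ℕ), F (Fin.snoc k (l + 1)) := by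
  rw [← (Fin.snocEquiv fun _ : Fin (d + 1) => ℕ).tsum_eq]
  refine (ENNReal.tsum_prod (f := fun (l : ℕ) (k : Fin d → ℕ) => F (Fin.snoc k l))).trans ?_
  rw [tsum_eq_zero_add' ENNReal.summable]

variable {b n m α d : ℕ} {γ : ℕ → ℝ}

lemma rvec_snoc_zero (k : Fin d → ℕ) :
    rvec b α γ (Fin.snoc k 0 : Fin (d + 1) → ℕ) = rvec b α γ k := by
  simp [rvec, Fin.prod_univ_castSucc]

lemma rvec_snoc_succ (k : Fin d → ℕ) (l : ℕ) :
    rvec b α γ (Fin.snoc k (l + 1) : Fin (d + 1) → ℕ) =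
      rvec b α γ k * (γ d * ralpha b α (l + 1)) := by
  simp [rvec, Fin.prod_univ_castSucc]

lemma rvec_nonneg (hγ : ∀ j, 0 < γ j) (k : Fin d → ℕ) : 0 ≤ rvec b α γ k := by
  refine Finset.prod_nonneg fun j _ => ?_
  split_ifs
  · exact zero_le_one
  · exact mul_nonneg (hγ _).le (ralpha_nonneg _ _ _)

/-- `∑_{k ≥ 1} r_α(k)^t` as an extended nonnegative real. -/
def eSum (b α : ℕ) (t : ℝ) : ℝ≥0∞ := ∑' l : ℕ, ENNReal.ofReal (ralpha b α (l + 1)) ^ t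

lemma eSum_le (hb : 1 < b) (hα : 2 ≤ α) {τ : ℝ} (hτ : 1 ≤ τ) (hτα : τ < α) :
    eSum b α (1 / τ) ≤ ENNReal.ofReal (Cbat b α τ) := by
  refine ENNReal.tsum_le_of_sum_range_le fun M => ?_
  have ht : 0 ≤ 1 / τ := by positivity
  refine le_trans (le_of_eq ?_) (ENNReal.ofReal_le_ofReal (sum_ralpha_rpow_le hb hα hτ hτα M))
  rw [ENNReal.ofReal_sum_of_nonneg fun _ _ => Real.rpow_nonneg (ralpha_nonneg _ _ _) _]
  exact Finset.sum_congr rfl fun _ _ => ENNReal.ofReal_rpow_of_nonneg (ralpha_nonneg _ _ _) ht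

lemma ofReal_rvec_snoc_succ_rpow (hγ : ∀ j, 0 < γ j) {t : ℝ} (ht : 0 ≤ t) (k : Fin d → ℕ)
    (l : ℕ) : ENNReal.ofReal (rvec b α γ (Fin.snoc k (l + 1) : Fin (d + 1) → ℕ)) ^ t =
      ENNReal.ofReal (rvec b α γ k) ^ t *
        (ENNReal.ofReal (γ d) ^ t * ENNReal.ofReal (ralpha b α (l + 1)) ^ t) := by
  rw [rvec_snoc_succ, ENNReal.ofReal_mul (rvec_nonneg hγ k), ENNReal.ofReal_mul (hγ d).le,
    ENNReal.mul_rpow_of_nonneg _ _ ht, ENNReal.mul_rpow_of_nonneg _ _ ht]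

lemma tsum_rvec_rpow (hγ : ∀ j, 0 < γ j) {t : ℝ} (ht : 0 ≤ t) (d : ℕ) :
    ∑' k : Fin d → ℕ, ENNReal.ofReal (rvec b α γ k) ^ t =
      ∏ j ∈ Finset.range d, (1 + ENNReal.ofReal (γ j) ^ t * eSum b α t) := by
  induction d with
  | zero => simp [rvec]
  | succ d ih =>
    rw [ENNReal.tsum_fin_succ, Finset.prod_range_succ, ← ih]
    simp only [rvec_snoc_zero, ofReal_rvec_snoc_succ_rpow hγ ht, ENNReal.tsum_mul_left,
      ENNReal.tsum_mul_right, eSum]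
    ring

lemma ofReal_ralpha_le (hb : 1 < b) (hα : 1 ≤ α) {k : ℕ} (hk : k / b ^ n ≠ 0) :
    ENNReal.ofReal (ralpha b α k) ≤
      ENNReal.ofReal ((b : ℝ) ^ n)⁻¹ * ENNReal.ofReal (ralpha b α (k / b ^ n)) := by
  have hb' : (1 : ℝ) < b := by exact_mod_cast hb
  rw [← ENNReal.ofReal_mul (by positivity)]
  refine ENNReal.ofReal_le_ofReal ?_
  rw [ralpha_eq, ralpha_eq, ← mul_inv, ← pow_add]
  refine inv_anti₀ (by positivity) (pow_le_pow_right₀ hb'.le ?_)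
  have := topExp_div_pow_add_le hb hα n k hk
  omega

variable [Fact (Nat.Prime b)] {p : Polynomial (ZMod b)}

/-- The worst-case error as an extended nonnegative real. -/
def eWce (b n m α : ℕ) (γ : ℕ → ℝ) {d : ℕ} (p : Polynomial (ZMod b))
    (Q : Fin d → Polynomial (ZMod b)) : ℝ≥0∞ :=
  ∑' k : Fin d → ℕ, if k ≠ 0 ∧ inDual b n m p Q k then ENNReal.ofReal (rvec b α γ k) else 0

/-- The part of the worst-case error of `(Q, q)` coming from the `k` with nonzero last
component. -/
def eTheta (b n m α : ℕ) (γ : ℕ → ℝ) {d : ℕ} (p : Polynomial (ZMod b))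
    (Q : Fin d → Polynomial (ZMod b)) (q : Polynomial (ZMod b)) : ℝ≥0∞ :=
  ∑' (l : ℕ) (k : Fin d → ℕ),
    if inDual b n m p (Fin.snoc Q q : Fin (d + 1) → Polynomial (ZMod b)) (Fin.snoc k (l + 1)) then
      ENNReal.ofReal (rvec b α γ (Fin.snoc k (l + 1) : Fin (d + 1) → ℕ)) else 0

lemma wce_eq_toReal (hγ : ∀ j, 0 < γ j) (Q : Fin d → Polynomial (ZMod b)) :
    wce b n m α γ p Q = (eWce b n m α γ p Q).toReal := by
  rw [eWce, ENNReal.tsum_toReal_eq (fun k => by split_ifs <;> simp), wce]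
  refine tsum_congr fun k => ?_
  split_ifs
  · rw [ENNReal.toReal_ofReal (rvec_nonneg hγ k)]
  · rfl

lemma eWce_ne_top (hα : 2 ≤ α) (hγ : ∀ j, 0 < γ j) (Q : Fin d → Polynomial (ZMod b)) :
    eWce b n m α γ p Q ≠ ∞ := by
  have hb : 1 < b := (Fact.out : Nat.Prime b).one_lt
  have hα' : (1 : ℝ) < α := by exact_mod_cast hα
  have hS : eSum b α 1 ≠ ∞ := by
    have := eSum_le hb hα le_rfl hα'
    rw [div_one] at this
    exact ne_top_of_le_ne_top ENNReal.ofReal_ne_top this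
  have h1 : eWce b n m α γ p Q ≤ ∑' k : Fin d → ℕ, ENNReal.ofReal (rvec b α γ k) ^ (1 : ℝ) := by
    refine ENNReal.tsum_le_tsum fun k => ?_
    rw [ENNReal.rpow_one]
    split_ifs <;> simp
  refine ne_top_of_le_ne_top ?_ h1
  rw [tsum_rvec_rpow hγ zero_le_one]
  refine ENNReal.prod_ne_top fun j _ => ?_
  rw [ENNReal.rpow_one]
  exact ENNReal.add_ne_top.2 ⟨ENNReal.one_ne_top, ENNReal.mul_ne_top ENNReal.ofReal_ne_top hS⟩

lemma inDual_snoc (Q : Fin d → Polynomial (ZMod b)) (q : Polynomial (ZMod b)) (k : Fin d → ℕ)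
    (l : ℕ) : inDual b n m p (Fin.snoc Q q : Fin (d + 1) → Polynomial (ZMod b)) (Fin.snoc k l) ↔
      ∃ a : Polynomial (ZMod b), a.degree < ((n - m : ℕ) : WithBot ℕ) ∧
        p ∣ (∑ j, natPoly b (k j) * Q j) + natPoly b l * q - a := by
  simp [inDual, Fin.sum_univ_castSucc]

lemma snoc_eq_zero_iff (k : Fin d → ℕ) (l : ℕ) :
    (Fin.snoc k l : Fin (d + 1) → ℕ) = 0 ↔ k = 0 ∧ l = 0 := by
  simp [funext_iff, Fin.forall_fin_succ']

lemma eWce_snoc (Q : Fin d → Polynomial (ZMod b)) (q : Polynomial (ZMod b)) :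
    eWce b n m α γ p (Fin.snoc Q q : Fin (d + 1) → Polynomial (ZMod b)) =
      eWce b n m α γ p Q + eTheta b n m α γ p Q q := by
  rw [eWce, ENNReal.tsum_fin_succ, eWce, eTheta]
  congr 1
  · refine tsum_congr fun k => ?_
    have h : inDual b n m p (Fin.snoc Q q : Fin (d + 1) → Polynomial (ZMod b)) (Fin.snoc k 0) ↔
        inDual b n m p Q k := by
      rw [inDual_snoc]
      simp only [natPoly_zero, zero_mul, add_zero, inDual]
    simp only [rvec_snoc_zero, h, Ne, snoc_eq_zero_iff, and_true]
  · simp only [Ne, snoc_eq_zero_iff, Nat.succ_ne_zero, and_false, not_false_eq_true, true_and]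

/-- The multiples of `p` among the `k ≥ 1` contribute at most a fraction `b^{-nt}` of the sum of
all `r_α(k)^t`. -/
lemma tsum_dvd_le (hα : 1 ≤ α) (hdeg : p.natDegree = n) {t : ℝ} (ht : 0 ≤ t) :
    (∑' l : ℕ, if p ∣ natPoly b (l + 1) then ENNReal.ofReal (ralpha b α (l + 1)) ^ t else 0) ≤
      ENNReal.ofReal ((b : ℝ) ^ n)⁻¹ ^ t * eSum b α t := by
  have hb : 1 < b := (Fact.out : Nat.Prime b).one_lt
  have hne : ∀ l : ℕ, p ∣ natPoly b (l + 1) → (l + 1) / b ^ n ≠ 0 := by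
    intro l hl h0
    have := eq_of_dvd_of_div_pow_eq hb hdeg hl (l := 0) (by simp [natPoly_zero])
      (by rw [h0, Nat.zero_div])
    omega
  let s : Set ℕ := {l | p ∣ natPoly b (l + 1)}
  let g : ℕ → ℝ≥0∞ := fun l => ENNReal.ofReal (ralpha b α (l + 1)) ^ t
  have hinj : Function.Injective fun l : s => ((l : ℕ) + 1) / b ^ n - 1 := by
    rintro ⟨l, hl⟩ ⟨l', hl'⟩ h
    have h1 := hne l hl
    have h2 := hne l' hl'
    simp only at h
    have h3 : (l + 1) / b ^ n = (l' + 1) / b ^ n :=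
      Nat.pred_inj (Nat.pos_of_ne_zero h1) (Nat.pos_of_ne_zero h2) h
    have := eq_of_dvd_of_div_pow_eq hb hdeg hl hl' h3
    exact Subtype.ext (by simpa using this)
  calc (∑' l : ℕ, if p ∣ natPoly b (l + 1) then ENNReal.ofReal (ralpha b α (l + 1)) ^ t else 0)
      = ∑' l : s, g l := by
        rw [tsum_subtype]
        refine tsum_congr fun l => ?_
        simp [Set.indicator_apply, s, g]
    _ ≤ ∑' l : s, ENNReal.ofReal ((b : ℝ) ^ n)⁻¹ ^ t * g (((l : ℕ) + 1) / b ^ n - 1) := by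
        refine ENNReal.tsum_le_tsum fun l => ?_
        have h1 := hne l l.2
        simp only [g]
        rw [Nat.sub_add_cancel (Nat.one_le_iff_ne_zero.2 h1), ← ENNReal.mul_rpow_of_nonneg _ _ ht]
        exact ENNReal.rpow_le_rpow (ofReal_ralpha_le hb hα h1) ht
    _ ≤ _ := by
        rw [ENNReal.tsum_mul_left]
        gcongr
        exact ENNReal.tsum_comp_le_tsum_of_injective hinj g

lemma sum_ite_inDual_le (hp : Irreducible p) (hdeg : p.natDegree = n)
    (Q : Fin d → Polynomial (ZMod b)) (k : Fin d → ℕ) (l : ℕ) (w : ℝ≥0∞) :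
    (∑ h ∈ Finset.Ico 1 (b ^ n),
      if inDual b n m p (Fin.snoc Q (natPoly b h) : Fin (d + 1) → Polynomial (ZMod b))
        (Fin.snoc k l) then w else 0) ≤
      ((if p ∣ natPoly b l then ((b ^ n - 1 : ℕ) : ℝ≥0∞) else 0) + ((b ^ (n - m) : ℕ) : ℝ≥0∞)) *
        w := by
  rw [← Finset.sum_filter, Finset.sum_const, nsmul_eq_mul]
  gcongr
  split_ifs with h
  · refine le_add_right (Nat.cast_le.2 ((Finset.card_filter_le _ _).trans ?_))
    simp
  · rw [zero_add, Nat.cast_le]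
    simp only [inDual_snoc]
    exact card_filter_congr_le hp hdeg _ _ h _ fun h' hh => (Finset.mem_Ico.1 hh).2

lemma eTheta_rpow_le (hγ : ∀ j, 0 < γ j) {t : ℝ} (ht : 0 < t) (ht1 : t ≤ 1)
    (Q : Fin d → Polynomial (ZMod b)) (q : Polynomial (ZMod b)) :
    eTheta b n m α γ p Q q ^ t ≤ ∑' (l : ℕ) (k : Fin d → ℕ),
      if inDual b n m p (Fin.snoc Q q : Fin (d + 1) → Polynomial (ZMod b)) (Fin.snoc k (l + 1)) then
        ENNReal.ofReal (rvec b α γ k) ^ t *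
          (ENNReal.ofReal (γ d) ^ t * ENNReal.ofReal (ralpha b α (l + 1)) ^ t) else 0 := by
  refine (ENNReal.tsum_rpow_le_tsum_rpow _ ht ht1).trans (ENNReal.tsum_le_tsum fun l => ?_)
  refine (ENNReal.tsum_rpow_le_tsum_rpow _ ht ht1).trans (ENNReal.tsum_le_tsum fun k => ?_)
  split_ifs
  · rw [ofReal_rvec_snoc_succ_rpow hγ ht.le]
  · rw [ENNReal.zero_rpow_of_pos ht]

/-- A value not exceeding any `eTheta Q q` is bounded by averaging over `q`. -/
lemma rpow_mul_le_of_forall_le_eTheta (hα : 1 ≤ α) (hγ : ∀ j, 0 < γ j) (hp : Irreducible p)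
    (hdeg : p.natDegree = n) {t : ℝ} (ht : 0 < t) (ht1 : t ≤ 1)
    (Q : Fin d → Polynomial (ZMod b)) {θ : ℝ≥0∞}
    (hθ : ∀ h ∈ Finset.Ico 1 (b ^ n), θ ≤ eTheta b n m α γ p Q (natPoly b h)) :
    θ ^ t * ((b ^ n - 1 : ℕ) : ℝ≥0∞) ≤
      (ENNReal.ofReal ((b : ℝ) ^ n)⁻¹ ^ t * ((b ^ n - 1 : ℕ) : ℝ≥0∞) +
        ((b ^ (n - m) : ℕ) : ℝ≥0∞)) * (ENNReal.ofReal (γ d) ^ t * eSum b α t) *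
        ∏ j ∈ Finset.range d, (1 + ENNReal.ofReal (γ j) ^ t * eSum b α t) := by
  set N : ℝ≥0∞ := ((b ^ n - 1 : ℕ) : ℝ≥0∞) with hN
  set R : ℝ≥0∞ := ((b ^ (n - m) : ℕ) : ℝ≥0∞)
  set g : ℕ → ℝ≥0∞ := fun l => ENNReal.ofReal (ralpha b α (l + 1)) ^ t with hg
  set w : (Fin d → ℕ) → ℝ≥0∞ := fun k => ENNReal.ofReal (rvec b α γ k) ^ t with hw
  set G : ℝ≥0∞ := ENNReal.ofReal (γ d) ^ t
  calc θ ^ t * N = ∑ h ∈ Finset.Ico 1 (b ^ n), θ ^ t := by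
        rw [Finset.sum_const, nsmul_eq_mul, Nat.card_Ico, mul_comm]
    _ ≤ ∑ h ∈ Finset.Ico 1 (b ^ n), ∑' (l : ℕ) (k : Fin d → ℕ),
          if inDual b n m p (Fin.snoc Q (natPoly b h) : Fin (d + 1) → Polynomial (ZMod b))
            (Fin.snoc k (l + 1)) then w k * (G * g l) else 0 :=
        Finset.sum_le_sum fun h hh => (ENNReal.rpow_le_rpow (hθ h hh) ht.le).trans
          (eTheta_rpow_le hγ ht ht1 Q _)
    _ = ∑' (l : ℕ) (k : Fin d → ℕ), ∑ h ∈ Finset.Ico 1 (b ^ n),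
          if inDual b n m p (Fin.snoc Q (natPoly b h) : Fin (d + 1) → Polynomial (ZMod b))
            (Fin.snoc k (l + 1)) then w k * (G * g l) else 0 := by
        rw [← Summable.tsum_finsetSum fun _ _ => ENNReal.summable]
        refine tsum_congr fun l => ?_
        rw [← Summable.tsum_finsetSum fun _ _ => ENNReal.summable]
    _ ≤ ∑' (l : ℕ) (k : Fin d → ℕ),
          ((if p ∣ natPoly b (l + 1) then N else 0) + R) * (w k * (G * g l)) :=
        ENNReal.tsum_le_tsum fun l => ENNReal.tsum_le_tsum fun k =>
          sum_ite_inDual_le hp hdeg Q k (l + 1) _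
    _ = ∑' l : ℕ, (N * (if p ∣ natPoly b (l + 1) then g l else 0) + R * g l) *
          (G * ∑' k, w k) := by
        refine tsum_congr fun l => ?_
        rw [ENNReal.tsum_mul_left, ENNReal.tsum_mul_right]
        split_ifs <;> ring
    _ = (N * (∑' l : ℕ, if p ∣ natPoly b (l + 1) then g l else 0) + R * ∑' l, g l) *
          (G * ∑' k, w k) := by
        rw [ENNReal.tsum_mul_right, ENNReal.tsum_add, ENNReal.tsum_mul_left, ENNReal.tsum_mul_left]
    _ ≤ (N * (ENNReal.ofReal ((b : ℝ) ^ n)⁻¹ ^ t * eSum b α t) + R * eSum b α t) *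
          (G * ∏ j ∈ Finset.range d, (1 + ENNReal.ofReal (γ j) ^ t * eSum b α t)) := by
        rw [← tsum_rvec_rpow hγ ht.le]
        gcongr
        · exact tsum_dvd_le hα hdeg ht.le
        · exact le_rfl
    _ = _ := by ring

end ExtendedSums

section Induction

open scoped ENNReal

lemma castLE_eq_snoc {M : Type*} {s d : ℕ} (hd : d < s) (q : Fin s → M) :
    (fun j : Fin (d + 1) => q (Fin.castLE hd j)) =
      (Fin.snoc (fun j : Fin d => q (Fin.castLE hd.le j)) (q ⟨d, hd⟩) : Fin (d + 1) → M) := by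
  funext j
  refine Fin.lastCases ?_ (fun i => ?_) j
  · simp only [Fin.snoc_last]; rfl
  · simp only [Fin.snoc_castSucc]; rfl

lemma ite_castLE_eq_snoc {M : Type*} {s d : ℕ} (hd : d < s) (q : Fin s → M) (c : M) :
    (fun j : Fin (d + 1) => if (j : ℕ) = d then c else q (Fin.castLE hd j)) =
      (Fin.snoc (fun j : Fin d => q (Fin.castLE hd.le j)) c : Fin (d + 1) → M) := by
  funext j
  refine Fin.lastCases ?_ (fun i => ?_) j
  · simp
  · simp only [Fin.snoc_castSucc, Fin.val_castSucc, i.2.ne, if_false]; rfl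

variable {b n m α d : ℕ} {γ : ℕ → ℝ}

lemma inv_pow_rpow_le (hb : 1 < b) {τ : ℝ} (hτ : 1 ≤ τ) :
    ENNReal.ofReal ((b : ℝ) ^ n)⁻¹ ^ (1 / τ) ≤
      ENNReal.ofReal ((b : ℝ) ^ (-(min (m : ℝ) (n / τ)))) := by
  have hb' : (1 : ℝ) < b := by exact_mod_cast hb
  rw [ENNReal.ofReal_rpow_of_nonneg (by positivity) (by positivity)]
  refine ENNReal.ofReal_le_ofReal ?_
  rw [← Real.rpow_natCast, ← Real.rpow_neg (by positivity), ← Real.rpow_mul (by positivity)]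
  refine Real.rpow_le_rpow_of_exponent_le hb'.le ?_
  have := min_le_right (m : ℝ) (n / τ)
  have h : -(n : ℝ) * (1 / τ) = -(n / τ) := by ring
  linarith

lemma pow_sub_le (hb : 1 < b) (hmn : m ≤ n) (hn : 1 ≤ n) (x : ℝ) :
    ((b ^ (n - m) : ℕ) : ℝ≥0∞) ≤
      2 * ENNReal.ofReal ((b : ℝ) ^ (-(min (m : ℝ) x))) * ((b ^ n - 1 : ℕ) : ℝ≥0∞) := by
  have hb' : (1 : ℝ) < b := by exact_mod_cast hb
  have hbn : 2 ≤ b ^ n := hb.trans_le (Nat.le_self_pow (by omega) b)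
  have h2 : (2 : ℝ≥0∞) = ENNReal.ofReal 2 := by simp
  rw [h2, ← ENNReal.ofReal_natCast, ← ENNReal.ofReal_natCast (b ^ n - 1),
    ← ENNReal.ofReal_mul (by positivity), ← ENNReal.ofReal_mul (by positivity)]
  refine ENNReal.ofReal_le_ofReal ?_
  have h3 : (b : ℝ) ^ (-(m : ℝ)) ≤ (b : ℝ) ^ (-(min (m : ℝ) x)) :=
    Real.rpow_le_rpow_of_exponent_le hb'.le (neg_le_neg (min_le_left _ _))
  have h4 : (b : ℝ) ^ n ≤ 2 * ((b ^ n - 1 : ℕ) : ℝ) := by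
    rw [Nat.cast_sub (by omega)]
    have : (2 : ℝ) ≤ (b : ℝ) ^ n := by exact_mod_cast hbn
    push_cast
    linarith
  have h5 : ((b ^ (n - m) : ℕ) : ℝ) = (b : ℝ) ^ (-(m : ℝ)) * (b : ℝ) ^ n := by
    rw [Nat.cast_pow, ← Real.rpow_natCast, ← Real.rpow_natCast, ← Real.rpow_add (by positivity),
      Nat.cast_sub hmn]
    congr 1
    ring
  rw [h5]
  calc _ ≤ (b : ℝ) ^ (-(min (m : ℝ) x)) * (2 * ((b ^ n - 1 : ℕ) : ℝ)) := by gcongr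
    _ = _ := by ring

variable [Fact (Nat.Prime b)] {p : Polynomial (ZMod b)}

lemma rpow_le_of_forall_le_eTheta (hm : 1 ≤ m) (hmn : m ≤ n) (hα : 2 ≤ α) (hγ : ∀ j, 0 < γ j)
    (hp : Irreducible p) (hdeg : p.natDegree = n) {τ : ℝ} (hτ : 1 ≤ τ) (hτα : τ < α)
    (Q : Fin d → Polynomial (ZMod b)) {θ : ℝ≥0∞}
    (hθ : ∀ h ∈ Finset.Ico 1 (b ^ n), θ ≤ eTheta b n m α γ p Q (natPoly b h)) :
    θ ^ (1 / τ) ≤ ENNReal.ofReal ((b : ℝ) ^ (-(min (m : ℝ) (n / τ)))) *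
      (3 * ENNReal.ofReal (γ d) ^ (1 / τ) * ENNReal.ofReal (Cbat b α τ)) *
        ∏ j ∈ Finset.range d,
          (1 + 3 * ENNReal.ofReal (γ j) ^ (1 / τ) * ENNReal.ofReal (Cbat b α τ)) := by
  have hb : 1 < b := (Fact.out : Nat.Prime b).one_lt
  have hbn : 2 ≤ b ^ n := hb.trans_le (Nat.le_self_pow (by omega) b)
  have hN0 : ((b ^ n - 1 : ℕ) : ℝ≥0∞) ≠ 0 := Nat.cast_ne_zero.2 (by omega)
  rw [← ENNReal.mul_le_mul_iff_left hN0 (ENNReal.natCast_ne_top _)]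
  refine (rpow_mul_le_of_forall_le_eTheta (by omega) hγ hp hdeg (by positivity)
    ((div_le_one (by linarith)).2 hτ) Q hθ).trans ?_
  have hS := eSum_le hb hα hτ hτα
  have h1 := inv_pow_rpow_le (n := n) (m := m) hb hτ
  have h2 := pow_sub_le hb hmn (by omega : 1 ≤ n) (n / τ)
  set B := ENNReal.ofReal ((b : ℝ) ^ (-(min (m : ℝ) (n / τ))))
  set N := ((b ^ n - 1 : ℕ) : ℝ≥0∞)
  set c := ENNReal.ofReal (Cbat b α τ)
  calc _ ≤ (B * N + 2 * B * N) * (ENNReal.ofReal (γ d) ^ (1 / τ) * c) *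
        ∏ j ∈ Finset.range d, (1 + 3 * ENNReal.ofReal (γ j) ^ (1 / τ) * c) := by
        gcongr with j
        exact le_mul_of_one_le_left' (by norm_num)
    _ = _ := by ring

/-- The component-by-component bound in `ℝ≥0∞`. -/
lemma eWce_rpow_le {s : ℕ} (hm : 1 ≤ m) (hmn : m ≤ n) (hα : 2 ≤ α) (hγ : ∀ j, 0 < γ j)
    (hp : Irreducible p) (hdeg : p.natDegree = n) (q : Fin s → Polynomial (ZMod b))
    (hcbc : ∀ (d : ℕ) (hd : d < s), ∀ cand : Polynomial (ZMod b),
      cand ≠ 0 → cand.degree < (n : WithBot ℕ) →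
        wce b n m α γ p (fun j : Fin (d + 1) => q (Fin.castLE hd j)) ≤
          wce b n m α γ p
            (fun j : Fin (d + 1) => if (j : ℕ) = d then cand else q (Fin.castLE hd j)))
    {τ : ℝ} (hτ : 1 ≤ τ) (hτα : τ < α) (d : ℕ) (hds : d ≤ s) :
    eWce b n m α γ p (fun j : Fin d => q (Fin.castLE hds j)) ^ (1 / τ) ≤
      ENNReal.ofReal ((b : ℝ) ^ (-(min (m : ℝ) (n / τ)))) * ∏ j ∈ Finset.range d,
        (1 + 3 * ENNReal.ofReal (γ j) ^ (1 / τ) * ENNReal.ofReal (Cbat b α τ)) := by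
  have hb : 1 < b := (Fact.out : Nat.Prime b).one_lt
  have ht : 0 < 1 / τ := by positivity
  induction d with
  | zero =>
    have : eWce b n m α γ p (fun j : Fin 0 => q (Fin.castLE hds j)) = 0 := by
      rw [eWce, ENNReal.tsum_eq_zero]
      intro k
      rw [if_neg]
      rintro ⟨hk, -⟩
      exact hk (Subsingleton.elim _ _)
    rw [this, ENNReal.zero_rpow_of_pos ht]
    exact zero_le
  | succ d ih =>
    have hd : d < s := hds
    set Q : Fin d → Polynomial (ZMod b) := fun j => q (Fin.castLE hd.le j)
    have hmin : ∀ h ∈ Finset.Ico 1 (b ^ n),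
        eTheta b n m α γ p Q (q ⟨d, hd⟩) ≤ eTheta b n m α γ p Q (natPoly b h) := by
      intro h hh
      rw [Finset.mem_Ico] at hh
      have := hcbc d hd (natPoly b h) (natPoly_ne_zero hb (by omega)) (degree_natPoly_lt hb hh.2)
      rw [castLE_eq_snoc hd, ite_castLE_eq_snoc hd, wce_eq_toReal hγ, wce_eq_toReal hγ,
        ENNReal.toReal_le_toReal (eWce_ne_top hα hγ _) (eWce_ne_top hα hγ _), eWce_snoc,
        eWce_snoc] at this
      exact (ENNReal.add_le_add_iff_left (eWce_ne_top hα hγ _)).1 this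
    have hθ := rpow_le_of_forall_le_eTheta hm hmn hα hγ hp hdeg hτ hτα Q hmin
    rw [castLE_eq_snoc hd, eWce_snoc]
    refine (ENNReal.rpow_add_le_add_rpow _ _ ht.le ((div_le_one (by linarith)).2 hτ)).trans
      ((add_le_add (ih hd.le) hθ).trans_eq ?_)
    rw [Finset.prod_range_succ]
    ring

lemma Cbat_nonneg (hα : 2 ≤ α) {τ : ℝ} (hτ : 1 ≤ τ) (hτα : τ < α) : 0 ≤ Cbat b α τ := by
  simpa using sum_ralpha_rpow_le (Fact.out : Nat.Prime b).one_lt hα hτ hτα 0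

end Induction

/-- Error bound for the component-by-component construction of higher order polynomial
lattice rules. -/
theorem stmt1 (b n m s α : ℕ) [Fact (Nat.Prime b)] (hm : 1 ≤ m) (hmn : m ≤ n)
    (hs : 1 ≤ s) (hα : 2 ≤ α) (γ : ℕ → ℝ) (hγ : ∀ j, 0 < γ j)
    (p : Polynomial (ZMod b)) (hp : Irreducible p) (hdeg : p.natDegree = n)
    (q : Fin s → Polynomial (ZMod b))
    (hqG : ∀ j, q j ≠ 0 ∧ (q j).degree < (n : WithBot ℕ))
    (hcbc : ∀ (d : ℕ) (hd : d < s), ∀ cand : Polynomial (ZMod b),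
      cand ≠ 0 → cand.degree < (n : WithBot ℕ) →
        wce b n m α γ p (fun j : Fin (d + 1) => q (Fin.castLE hd j)) ≤
          wce b n m α γ p
            (fun j : Fin (d + 1) => if (j : ℕ) = d then cand else q (Fin.castLE hd j))) :
    ∀ (d : ℕ), 1 ≤ d → ∀ (hds : d ≤ s), ∀ τ : ℝ, 1 ≤ τ → τ < α →
      wce b n m α γ p (fun j : Fin d => q (Fin.castLE hds j)) ≤
        (b : ℝ) ^ (-(min (τ * m) (n : ℝ))) *
          ∏ j ∈ Finset.range d, (1 + 3 * γ j ^ (1 / τ) * Cbat b α τ) ^ τ := by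
  intro d _ hds τ hτ hτα
  have hτ0 : 0 < τ := by linarith
  have ht : 0 ≤ 1 / τ := by positivity
  have hb' : (0 : ℝ) < b := by exact_mod_cast (Fact.out : Nat.Prime b).pos
  have hC : 0 ≤ Cbat b α τ := Cbat_nonneg hα hτ hτα
  have hfac : ∀ j, 0 ≤ 1 + 3 * γ j ^ (1 / τ) * Cbat b α τ := fun j => by
    have := (hγ j).le
    positivity
  have hX : 0 ≤ (b : ℝ) ^ (-(min (m : ℝ) (n / τ))) *
      ∏ j ∈ Finset.range d, (1 + 3 * γ j ^ (1 / τ) * Cbat b α τ) :=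
    mul_nonneg (by positivity) (Finset.prod_nonneg fun j _ => hfac j)
  have key := eWce_rpow_le hm hmn hα hγ hp hdeg q hcbc hτ hτα d hds
  have hprod : ∏ j ∈ Finset.range d,
      (1 + 3 * ENNReal.ofReal (γ j) ^ (1 / τ) * ENNReal.ofReal (Cbat b α τ)) =
      ENNReal.ofReal (∏ j ∈ Finset.range d, (1 + 3 * γ j ^ (1 / τ) * Cbat b α τ)) := by
    rw [ENNReal.ofReal_prod_of_nonneg fun j _ => hfac j]
    refine Finset.prod_congr rfl fun j _ => ?_
    have hj := (hγ j).le
    rw [ENNReal.ofReal_add zero_le_one (by positivity), ENNReal.ofReal_mul (by positivity),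
      ENNReal.ofReal_mul (by norm_num), ENNReal.ofReal_rpow_of_nonneg hj ht]
    simp
  rw [hprod, ← ENNReal.ofReal_mul (by positivity), one_div,
    ENNReal.rpow_inv_le_iff hτ0, ← one_div, ENNReal.ofReal_rpow_of_nonneg hX hτ0.le] at key
  rw [wce_eq_toReal hγ]
  refine (ENNReal.toReal_le_of_le_ofReal (Real.rpow_nonneg hX τ) key).trans_eq ?_
  rw [Real.mul_rpow (by positivity) (Finset.prod_nonneg fun j _ => hfac j),
    ← Real.finsetProd_rpow _ _ fun j _ => hfac j, ← Real.rpow_mul hb'.le]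
  congr 2
  rw [neg_mul, min_mul_of_nonneg _ _ hτ0.le, div_mul_cancel₀ _ hτ0.ne', mul_comm]
end
end

section
/- Let b ≥ 2 and t ≥ 1 be integers and let n ≥ 0 be an integer. Then the (absolutely convergent) infinite sum over all strictly decreasing t-tuples of integers a_1 > a_2 > ⋯ > a_t ≥ n of the product ∏_{i=1}^{t} (b−1) b^{−(a_i+1)} equals b^{−nt} ∏_{i=1}^{t} (b−1)/(b^i − 1). -/
open scoped BigOperators

noncomputable section

/-- The strictly decreasing `t`-tuples of integers bounded below by `n`. -/
abbrev DecreasingTuple (t n : ℕ) : Type :=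
  {a : Fin t → ℤ // StrictAnti a ∧ ∀ i, (n : ℤ) ≤ a i}

namespace DecreasingTuple

/-- Append the new smallest entry `n + m` to a decreasing tuple with entries above `n + m`. -/
def append (t n : ℕ) (x : Σ m : ℕ, DecreasingTuple t (n + m + 1)) :
    DecreasingTuple (t + 1) n :=
  ⟨Fin.snoc (α := fun _ => ℤ) x.2.1 ((n + x.1 : ℕ) : ℤ), by
    obtain ⟨m, a, ha, hn⟩ := x
    constructor
    · intro i j hij
      induction j using Fin.lastCases with
      | last =>
        induction i using Fin.lastCases with
        | last => exact absurd hij (lt_irrefl _)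
        | cast i =>
          have := hn i
          simp only [Fin.snoc_castSucc, Fin.snoc_last]
          push_cast at this ⊢
          omega
      | cast j =>
        induction i using Fin.lastCases with
        | last => exact absurd hij (Fin.castSucc_lt_last j).not_gt
        | cast i =>
          simp only [Fin.snoc_castSucc]
          exact ha (by simpa using hij)
    · intro i
      induction i using Fin.lastCases with
      | last => simp
      | cast i =>
        have := hn i
        simp only [Fin.snoc_castSucc]
        push_cast at this
        omega⟩

lemma append_bijective (t n : ℕ) : Function.Bijective (append t n) := by
  constructor
  · rintro ⟨m, a, ha⟩ ⟨m', a', ha'⟩ h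
    have h' := congrArg Subtype.val h
    simp only [append] at h'
    obtain ⟨h1, h2⟩ := Fin.snoc_inj.mp h'
    obtain rfl : m = m' := by push_cast at h2; omega
    subst h1
    rfl
  · rintro ⟨a, ha, hn⟩
    have hl := hn (Fin.last t)
    have hm : ((n + (a (Fin.last t) - n).toNat : ℕ) : ℤ) = a (Fin.last t) := by
      push_cast
      omega
    refine ⟨⟨(a (Fin.last t) - n).toNat, Fin.init a, fun i j hij => ha (by simpa using hij),
      fun i => ?_⟩, ?_⟩
    · have := ha (Fin.castSucc_lt_last i)
      simp only [Fin.init]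
      push_cast at hm ⊢
      omega
    · apply Subtype.ext
      simp only [append, hm]
      exact Fin.snoc_init_self a

end DecreasingTuple

/-- The geometric series of ratio `b⁻ᵏ` started with exponent `(n + 1) k`. -/
lemma hasSum_inv_pow_mul {b : ℝ} (hb : 1 < b) {k : ℕ} (hk : k ≠ 0) (n : ℕ) :
    HasSum (fun m : ℕ => (b ^ ((n + m + 1) * k))⁻¹) ((b ^ (n * k))⁻¹ / (b ^ k - 1)) := by
  have hb0 : 0 < b := by linarith
  have hbk : 1 < b ^ k := one_lt_pow₀ hb hk
  have h := (hasSum_geometric_of_lt_one (inv_nonneg.mpr (by positivity))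
    (inv_lt_one_of_one_lt₀ hbk)).mul_left (b ^ ((n + 1) * k))⁻¹
  have h1 : b ^ k - 1 ≠ 0 := by linarith
  have hval : (b ^ (n * k))⁻¹ / (b ^ k - 1) = (b ^ ((n + 1) * k))⁻¹ * (1 - (b ^ k)⁻¹)⁻¹ := by
    have h2 : 1 - (b ^ k)⁻¹ = (b ^ k - 1) / b ^ k := by field_simp
    rw [h2, add_mul, pow_add, one_mul]
    field_simp
  rw [hval]
  refine h.congr_fun fun m => ?_
  rw [inv_pow (b ^ k), ← pow_mul, ← mul_inv, ← pow_add]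
  ring_nf

lemma hasSum_decreasingTuple {b : ℝ} (hb : 1 < b) (t n : ℕ) :
    HasSum
      (fun a : DecreasingTuple t n => ∏ i, (b - 1) * (b ^ (a.1 i + 1))⁻¹)
      ((b ^ (n * t))⁻¹ * ∏ i ∈ Finset.range t, (b - 1) / (b ^ (i + 1) - 1)) := by
  have hb0 : 0 < b := by linarith
  have hb1 : 0 ≤ b - 1 := by linarith
  induction t generalizing n with
  | zero =>
    have : Unique (DecreasingTuple 0 n) :=
      { default := ⟨Fin.elim0, fun i => i.elim0, fun i => i.elim0⟩
        uniq := fun a => Subtype.ext (Subsingleton.elim _ _) }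
    simp
  | succ t ih =>
    rw [← (Equiv.ofBijective _ (DecreasingTuple.append_bijective t n)).hasSum_iff]
    set P := ∏ i ∈ Finset.range t, (b - 1) / (b ^ (i + 1) - 1) with hP
    have hfiber (m : ℕ) : HasSum
        (fun a : DecreasingTuple t (n + m + 1) =>
          ∏ i, (b - 1) * (b ^ ((DecreasingTuple.append t n ⟨m, a⟩).1 i + 1))⁻¹)
        ((b - 1) * P * (b ^ ((n + m + 1) * (t + 1)))⁻¹) := by
      have hval : (b - 1) * P * (b ^ ((n + m + 1) * (t + 1)))⁻¹ =
          (b ^ ((n + m + 1) * t))⁻¹ * P * ((b - 1) * (b ^ (n + m + 1))⁻¹) := by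
        rw [mul_add_one, pow_add, mul_inv]
        ring
      rw [hval]
      refine ((ih (n + m + 1)).mul_right ((b - 1) * (b ^ (n + m + 1))⁻¹)).congr_fun fun a => ?_
      rw [Fin.prod_univ_castSucc]
      simp only [DecreasingTuple.append, Fin.snoc_castSucc, Fin.snoc_last]
      norm_cast
    have houter := (hasSum_inv_pow_mul hb t.succ_ne_zero n).mul_left ((b - 1) * P)
    have hsummable : Summable ((fun a : DecreasingTuple (t + 1) n =>
        ∏ i, (b - 1) * (b ^ (a.1 i + 1))⁻¹) ∘ DecreasingTuple.append t n) := by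
      refine (summable_sigma_of_nonneg fun x => ?_).mpr ⟨fun m => (hfiber m).summable, ?_⟩
      · exact Finset.prod_nonneg fun i _ => by positivity
      · exact houter.summable.congr fun m => (hfiber m).tsum_eq.symm
    have hval : (b ^ (n * (t + 1)))⁻¹ * ∏ i ∈ Finset.range (t + 1), (b - 1) / (b ^ (i + 1) - 1) =
        (b - 1) * P * ((b ^ (n * (t + 1)))⁻¹ / (b ^ (t + 1) - 1)) := by
      rw [Finset.prod_range_succ, ← hP]
      ring
    rw [hval]
    exact HasSum.sigma_of_hasSum houter hfiber hsummable

/-- `∑_{a_1 > a_2 > ⋯ > a_t ≥ n} ∏_{i=1}^t (b-1) b^{-(a_i+1)}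
      = b^{-nt} ∏_{i=1}^t (b-1)/(b^i - 1)`. -/
theorem stmt3 (b : ℕ) (hb : 2 ≤ b) (t : ℕ) (ht : 1 ≤ t) (n : ℕ) :
    HasSum
      (fun a : {a : Fin t → ℤ // StrictAnti a ∧ ∀ i, (n : ℤ) ≤ a i} =>
        ∏ i, ((b : ℝ) - 1) * ((b : ℝ) ^ (a.1 i + 1))⁻¹)
      (((b : ℝ) ^ (n * t))⁻¹ * ∏ i ∈ Finset.range t, ((b : ℝ) - 1) / ((b : ℝ) ^ (i + 1) - 1)) :=
  hasSum_decreasingTuple (by exact_mod_cast hb) t n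
end
end

section
/- Let b ≥ 2 and α ≥ 2 be integers. Then the (absolutely convergent) infinite sum over all strictly decreasing α-tuples of integers a_1 > a_2 > ⋯ > a_α ≥ 0 of the product b^{a_α} ∏_{i=1}^{α} (b−1) b^{−(a_i+1)} equals (b−1)/(b^α − b) · ∏_{i=1}^{α−1} (b−1)/(b^i − 1). -/
open scoped BigOperators

noncomputable section

/-- A strictly decreasing tuple of naturals of length `n + 1` is determined by its last entry `m`
and the strictly decreasing tuple obtained by lowering the other entries by `m + 1`. -/
def strictAntiSnocEquiv (n : ℕ) :
    ℕ × {a : Fin n → ℕ // StrictAnti a} ≃ {a : Fin (n + 1) → ℕ // StrictAnti a} where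
  toFun p := ⟨Fin.snoc (α := fun _ => ℕ) (fun i => p.2.1 i + (p.1 + 1)) p.1, by
    intro i j hij
    induction j using Fin.lastCases with
    | last =>
      induction i using Fin.lastCases with
      | last => exact absurd hij (lt_irrefl _)
      | cast i => simp only [Fin.snoc_last, Fin.snoc_castSucc]; omega
    | cast j =>
      induction i using Fin.lastCases with
      | last => exact absurd hij (not_lt.2 (Fin.le_last _))
      | cast i =>
        have := p.2.2 (Fin.castSucc_lt_castSucc_iff.1 hij)
        simp only [Fin.snoc_castSucc]; omega⟩
  invFun a := (a.1 (Fin.last n), ⟨fun i => a.1 i.castSucc - (a.1 (Fin.last n) + 1), by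
    intro i j hij
    have h₁ := a.2 (Fin.castSucc_lt_castSucc_iff.2 hij)
    have h₂ := a.2 (Fin.castSucc_lt_last j)
    dsimp only; omega⟩)
  left_inv p := by
    rcases p with ⟨m, a, ha⟩
    simp
  right_inv a := by
    ext i
    induction i using Fin.lastCases with
    | last => simp
    | cast i =>
      have := a.2 (Fin.castSucc_lt_last i)
      simp only [Fin.snoc_castSucc]; omega

theorem strictAntiSnocEquiv_apply_last {n : ℕ} (p : ℕ × {a : Fin n → ℕ // StrictAnti a}) :
    (strictAntiSnocEquiv n p).1 (Fin.last n) = p.1 := by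
  simp [strictAntiSnocEquiv]

theorem strictAntiSnocEquiv_apply_castSucc {n : ℕ} (p : ℕ × {a : Fin n → ℕ // StrictAnti a})
    (i : Fin n) : (strictAntiSnocEquiv n p).1 i.castSucc = p.2.1 i + (p.1 + 1) := by
  simp [strictAntiSnocEquiv]

theorem hasSum_mul_of_nonneg {ι κ : Type*} {f : ι → ℝ} {g : κ → ℝ} {s t : ℝ}
    (hs : HasSum f s) (ht : HasSum g t) (hf : ∀ i, 0 ≤ f i) (hg : ∀ j, 0 ≤ g j) :
    HasSum (fun p : ι × κ => f p.1 * g p.2) (s * t) :=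
  hs.mul ht (hs.summable.mul_of_nonneg ht.summable hf hg)

theorem hasSum_strictAnti_snoc {b : ℝ} (hb : 1 ≤ b) {n : ℕ} {w : ℕ → ℝ} (hw : ∀ m, 0 ≤ w m)
    {s t : ℝ}
    (hs : HasSum (fun m => w m * ((b - 1) * ((b ^ (m + 1))⁻¹) ^ (n + 1))) s)
    (ht : HasSum (fun a : {a : Fin n → ℕ // StrictAnti a} =>
      ∏ i, (b - 1) * (b ^ (a.1 i + 1))⁻¹) t) :
    HasSum (fun a : {a : Fin (n + 1) → ℕ // StrictAnti a} =>
      w (a.1 (Fin.last n)) * ∏ i, (b - 1) * (b ^ (a.1 i + 1))⁻¹) (s * t) := by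
  have hb₁ : 0 ≤ b - 1 := sub_nonneg.2 hb
  have hb₀ : 0 ≤ b := by linarith
  rw [← (strictAntiSnocEquiv n).hasSum_iff]
  have hs₀ (m : ℕ) : 0 ≤ w m * ((b - 1) * ((b ^ (m + 1))⁻¹) ^ (n + 1)) :=
    mul_nonneg (hw m) (by positivity)
  have ht₀ (a : {a : Fin n → ℕ // StrictAnti a}) : 0 ≤ ∏ i, (b - 1) * (b ^ (a.1 i + 1))⁻¹ :=
    Finset.prod_nonneg fun i _ => by positivity
  refine (hasSum_mul_of_nonneg hs ht hs₀ ht₀).congr_fun fun p => ?_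
  have h : ∀ i, (b - 1) * (b ^ (p.2.1 i + (p.1 + 1) + 1))⁻¹ =
      (b ^ (p.1 + 1))⁻¹ * ((b - 1) * (b ^ (p.2.1 i + 1))⁻¹) := fun i => by
    rw [show p.2.1 i + (p.1 + 1) + 1 = (p.1 + 1) + (p.2.1 i + 1) by ring, pow_add, mul_inv]
    ring
  rw [Function.comp_apply, Fin.prod_univ_castSucc]
  simp only [strictAntiSnocEquiv_apply_last, strictAntiSnocEquiv_apply_castSucc, h]
  rw [Finset.prod_mul_distrib, Finset.prod_const, Finset.card_univ, Fintype.card_fin]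
  ring

theorem hasSum_inv_pow_succ_pow {b : ℝ} (hb : 1 < b) {n : ℕ} (hn : n ≠ 0) :
    HasSum (fun m : ℕ => ((b ^ (m + 1))⁻¹) ^ n) (b ^ n - 1)⁻¹ := by
  have h₁ : 1 < b ^ n := one_lt_pow₀ hb hn
  have h := (hasSum_geometric_of_lt_one (r := (b ^ n)⁻¹) (by positivity)
    (inv_lt_one_of_one_lt₀ h₁)).mul_left (b ^ n)⁻¹
  have h_sum : (b ^ n)⁻¹ * (1 - (b ^ n)⁻¹)⁻¹ = (b ^ n - 1)⁻¹ := by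
    have : b ^ n ≠ 0 := by linarith
    rw [← mul_inv, mul_sub, mul_inv_cancel₀ this, mul_one]
  rw [h_sum] at h
  refine h.congr_fun fun m => ?_
  rw [← pow_succ', inv_pow, inv_pow, ← pow_mul, ← pow_mul, mul_comm]

theorem hasSum_strictAnti_prod {b : ℝ} (hb : 1 < b) (n : ℕ) :
    HasSum (fun a : {a : Fin n → ℕ // StrictAnti a} => ∏ i, (b - 1) * (b ^ (a.1 i + 1))⁻¹)
      (∏ i ∈ Finset.range n, (b - 1) / (b ^ (i + 1) - 1)) := by
  induction n with
  | zero =>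
    have : Unique {a : Fin 0 → ℕ // StrictAnti a} :=
      { default := ⟨Fin.elim0, fun i => i.elim0⟩
        uniq := fun a => Subtype.ext (Subsingleton.elim _ _) }
    simp
  | succ n ih =>
    have h := hasSum_strictAnti_snoc hb.le (w := fun _ => 1) (fun _ => zero_le_one)
      (by simpa only [one_mul] using (hasSum_inv_pow_succ_pow hb n.succ_ne_zero).mul_left (b - 1)) ih
    simp only [one_mul] at h
    rwa [Finset.prod_range_succ, mul_comm, div_eq_mul_inv]

/-- `∑_{a_1 > a_2 > ⋯ > a_α ≥ 0} b^{a_α} ∏_{i=1}^α (b-1) b^{-(a_i+1)}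
      = (b-1)/(b^α - b) · ∏_{i=1}^{α-1} (b-1)/(b^i - 1)`, where `a_α` is the smallest entry. -/
theorem stmt4 (b α : ℕ) (hb : 2 ≤ b) (hα : 2 ≤ α) :
    HasSum
      (fun a : {a : Fin α → ℕ // StrictAnti a} =>
        (b : ℝ) ^ (a.1 ⟨α - 1, by omega⟩) *
          ∏ i, ((b : ℝ) - 1) * ((b : ℝ) ^ (a.1 i + 1))⁻¹)
      (((b : ℝ) - 1) / ((b : ℝ) ^ α - b) *
        ∏ i ∈ Finset.range (α - 1), ((b : ℝ) - 1) / ((b : ℝ) ^ (i + 1) - 1)) := by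
  have hb₁ : (1 : ℝ) < b := by exact_mod_cast hb
  have hb₀ : (b : ℝ) ≠ 0 := by positivity
  obtain ⟨n, rfl⟩ : ∃ n, α = n + 1 := ⟨α - 1, by omega⟩
  refine hasSum_strictAnti_snoc hb₁.le (w := fun m => (b : ℝ) ^ m) (fun m => by positivity) ?_
    (hasSum_strictAnti_prod hb₁ n)
  rw [show ((b : ℝ) - 1) / ((b : ℝ) ^ (n + 1) - b) = ((b : ℝ) - 1) / b * ((b : ℝ) ^ n - 1)⁻¹ by
    rw [show (b : ℝ) ^ (n + 1) - b = b * (b ^ n - 1) by ring, ← div_div, div_eq_mul_inv]]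
  refine ((hasSum_inv_pow_succ_pow hb₁ (n := n) (by omega)).mul_left
    (((b : ℝ) - 1) / b)).congr_fun fun m => ?_
  rw [pow_succ _ n]
  field_simp
  ring
end
end

section
/- Let b ≥ 2 and α ≥ 1 be integers and let x ∈ [0,1) with base-b digits ξ_1, ξ_2, …. Then the sum of r_α(k) wal_k(x) over all integers k ≥ 1 having exactly one non-zero base-b digit converges absolutely and equals s_1(x) := 1 − b ∑_{i ≥ 1 : ξ_i ≠ 0} b^{−i}. -/
open scoped BigOperators
open scoped Classical

noncomputable section

/-- `σ(x) = ∑_{i ≥ 1 : ξ_i ≠ 0} b^{-i}`, the sum of `b^{-i}` over the positions of the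
nonzero base-`b` digits of `x`. -/
def sigma1 (b : ℕ) (x : ℝ) : ℝ :=
  ∑' i : ℕ, if xdigit b x (i + 1) ≠ 0 then ((b : ℝ) ^ (i + 1))⁻¹ else 0

/-- `σ₂(x) = ∑_{i ≥ 1 : ξ_i ≠ 0} b^{-2i}`. -/
def sigma2 (b : ℕ) (x : ℝ) : ℝ :=
  ∑' i : ℕ, if xdigit b x (i + 1) ≠ 0 then ((b : ℝ) ^ (2 * (i + 1)))⁻¹ else 0

/-- `s_1(x) = 1 - b σ(x)`. -/
def s1f (b : ℕ) (x : ℝ) : ℝ := 1 - (b : ℝ) * sigma1 b x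

/-- `s_2(x) = 1/(b+1) - b(b-2)(σ(x)² - σ₂(x))/2 - b(b-1)(1/(b-1) - σ(x))σ(x)`. -/
def s2f (b : ℕ) (x : ℝ) : ℝ :=
  1 / ((b : ℝ) + 1) -
    (b : ℝ) * ((b : ℝ) - 2) * ((sigma1 b x) ^ 2 - sigma2 b x) / 2 -
    (b : ℝ) * ((b : ℝ) - 1) * (1 / ((b : ℝ) - 1) - sigma1 b x) * sigma1 b x

/-- `a_1(x)`: the position of the first nonzero base-`b` digit of `x` (junk value for `x = 0`). -/
def firstIdx (b : ℕ) (x : ℝ) : ℕ := sInf {i | xdigit b x i ≠ 0}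

theorem mod_pow_eq_sum_ndigit (b k n : ℕ) :
    k % b ^ n = ∑ i ∈ Finset.range n, ndigit b k i * b ^ i := by
  induction n with
  | zero => simp [Nat.mod_one]
  | succ n ih => rw [Nat.mod_pow_succ, Finset.sum_range_succ, ih, ndigit, mul_comm (b ^ n)]

theorem ndigit_mul_pow {b c : ℕ} (hb : 2 ≤ b) (hcb : c < b) (a i : ℕ) :
    ndigit b (c * b ^ a) i = if i = a then c else 0 := by
  have hb0 : 0 < b := by omega
  unfold ndigit
  rcases lt_trichotomy i a with h | rfl | h
  · obtain ⟨d, rfl⟩ := Nat.exists_eq_add_of_lt h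
    rw [if_neg h.ne, show c * b ^ (i + d + 1) = c * b ^ d * b * b ^ i by ring,
      Nat.mul_div_cancel _ (pow_pos hb0 i), Nat.mul_mod_left]
  · rw [if_pos rfl, Nat.mul_div_cancel _ (pow_pos hb0 i), Nat.mod_eq_of_lt hcb]
  · have : c * b ^ a < b ^ i := calc
      c * b ^ a < b * b ^ a := Nat.mul_lt_mul_of_pos_right hcb (pow_pos hb0 a)
      _ = b ^ (a + 1) := by ring
      _ ≤ b ^ i := Nat.pow_le_pow_right hb0 h
    rw [if_neg h.ne', Nat.div_eq_of_lt this, Nat.zero_mod]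

theorem le_mul_pow {b c : ℕ} (hb : 2 ≤ b) (hc : 0 < c) (a : ℕ) : a ≤ c * b ^ a :=
  (Nat.lt_pow_self (by omega : 1 < b)).le.trans (Nat.le_mul_of_pos_left _ hc)

theorem nzset_mul_pow {b c : ℕ} (hb : 2 ≤ b) (hc : 0 < c) (hcb : c < b) (a : ℕ) :
    nzset b (c * b ^ a) = {a} := by
  have := le_mul_pow hb hc a
  ext i
  simp only [nzset, Finset.mem_filter, Finset.mem_range, ndigit_mul_pow hb hcb,
    Finset.mem_singleton]
  constructor
  · rintro ⟨-, h⟩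
    by_contra hi
    simp [hi] at h
  · rintro rfl
    exact ⟨by omega, by simpa using hc.ne'⟩

theorem eq_mul_pow_of_nzset_eq {b k a : ℕ} (hb : 2 ≤ b) (h : nzset b k = {a}) :
    0 < ndigit b k a ∧ k = ndigit b k a * b ^ a := by
  have ha : a ∈ nzset b k := by simp [h]
  have ha' := Finset.mem_filter.1 ha
  refine ⟨Nat.pos_of_ne_zero ha'.2, ?_⟩
  have hk : k < b ^ (k + 1) :=
    (Nat.lt_succ_self k).trans (Nat.lt_pow_self (by omega : 1 < b))
  have hs := mod_pow_eq_sum_ndigit b k (k + 1)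
  rw [Nat.mod_eq_of_lt hk, Finset.sum_eq_single_of_mem a ha'.1] at hs
  · exact hs
  · intro i hi hia
    by_contra h0
    have : i ∈ nzset b k := Finset.mem_filter.2 ⟨hi, fun h => h0 (by simp [h])⟩
    exact hia (by simpa [h] using this)

theorem ralpha_mul_pow {b α c : ℕ} (hb : 2 ≤ b) (hα : 1 ≤ α) (hc : 0 < c) (hcb : c < b)
    (a : ℕ) : ralpha b α (c * b ^ a) = ((b : ℝ) ^ (a + 1))⁻¹ := by
  have : topPos b α (c * b ^ a) = {a} := by
    rw [topPos, nzset_mul_pow hb hc hcb, Finset.filter_singleton, if_pos]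
    rw [Finset.filter_singleton, if_neg (lt_irrefl a)]
    rw [Finset.card_empty]
    exact hα
  rw [ralpha, this, Finset.sum_singleton]

theorem wal_mul_pow {b c : ℕ} (hb : 2 ≤ b) (hc : 0 < c) (hcb : c < b) (a : ℕ) (x : ℝ) :
    wal b (c * b ^ a) x =
      (Complex.exp (2 * (Real.pi : ℂ) * Complex.I / (b : ℂ)) ^ xdigit b x (a + 1)) ^ c := by
  have := le_mul_pow hb hc a
  rw [wal, Finset.sum_eq_single_of_mem a (Finset.mem_range.2 (by omega)),
    ndigit_mul_pow hb hcb, if_pos rfl, ← pow_mul, ← Complex.exp_nat_mul]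
  · congr 1
    push_cast
    ring
  · intro i _ hi
    simp [ndigit_mul_pow hb hcb, hi]

theorem sum_pow_primitiveRoot {b : ℕ} (hb : 2 ≤ b) {ζ : ℂ} (hζ : IsPrimitiveRoot ζ b) {d : ℕ}
    (hd : d < b) :
    ∑ c : Fin (b - 1), (ζ ^ d) ^ ((c : ℕ) + 1) = ((b : ℂ) - 1) - b * if d ≠ 0 then 1 else 0 := by
  have hsum : ∑ c : Fin (b - 1), (ζ ^ d) ^ ((c : ℕ) + 1) =
      ∑ i ∈ Finset.range b, (ζ ^ d) ^ i - 1 := by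
    obtain ⟨n, rfl⟩ : ∃ n, b = n + 1 := ⟨b - 1, by omega⟩
    rw [Finset.sum_range_succ', Nat.add_sub_cancel,
      Fin.sum_univ_eq_sum_range (fun i => (ζ ^ d) ^ (i + 1)) n]
    simp
  rw [hsum]
  by_cases h0 : d = 0
  · simp [h0]
  · have h1 : ζ ^ d ≠ 1 := hζ.pow_ne_one_of_pos_of_lt h0 hd
    rw [geom_sum_eq h1, ← pow_mul, mul_comm d, pow_mul, hζ.pow_eq_one]
    simp [h0]

theorem mul_pow_injective {b : ℕ} (hb : 2 ≤ b) :
    Function.Injective fun p : ℕ × Fin (b - 1) => ((p.2 : ℕ) + 1) * b ^ p.1 := by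
  rintro ⟨a, c⟩ ⟨a', c'⟩ h
  have h' : ((c : ℕ) + 1) * b ^ a = ((c' : ℕ) + 1) * b ^ a' := h
  have hc : (c : ℕ) + 1 < b := by omega
  have hc' : (c' : ℕ) + 1 < b := by omega
  have ha : a = a' := by
    have := nzset_mul_pow hb (Nat.succ_pos c) hc a
    rw [Nat.succ_eq_add_one, h', nzset_mul_pow hb (Nat.succ_pos _) hc'] at this
    exact (Finset.singleton_injective this).symm
  subst ha
  have := Nat.eq_of_mul_eq_mul_right (pow_pos (by omega : 0 < b) a) h'
  exact Prod.ext rfl (Fin.ext (by simpa using this))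

theorem hasSum_inv_pow_succ {b : ℕ} (hb : 2 ≤ b) :
    HasSum (fun a : ℕ => ((b : ℝ) ^ (a + 1))⁻¹) ((b : ℝ) - 1)⁻¹ := by
  have hb' : (2 : ℝ) ≤ b := by exact_mod_cast hb
  have h := (hasSum_geometric_of_lt_one (r := (b : ℝ)⁻¹) (by positivity)
    (inv_lt_one_of_one_lt₀ (by linarith))).mul_left (b : ℝ)⁻¹
  have hval : (b : ℝ)⁻¹ * (1 - (b : ℝ)⁻¹)⁻¹ = ((b : ℝ) - 1)⁻¹ := by
    rw [← mul_inv, mul_sub, mul_one, mul_inv_cancel₀ (by linarith)]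
  rw [hval] at h
  refine h.congr_fun fun a => ?_
  rw [← inv_pow, pow_succ']

theorem hasSum_s1f {b : ℕ} (hb : 2 ≤ b) (x : ℝ) :
    HasSum (fun a : ℕ => ((b : ℝ) ^ (a + 1))⁻¹ *
      (((b : ℝ) - 1) - b * if xdigit b x (a + 1) ≠ 0 then 1 else 0)) (s1f b x) := by
  have hb' : (2 : ℝ) ≤ b := by exact_mod_cast hb
  have hg := hasSum_inv_pow_succ hb
  have hσ : Summable fun i : ℕ =>
      if xdigit b x (i + 1) ≠ 0 then ((b : ℝ) ^ (i + 1))⁻¹ else 0 := by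
    refine Summable.of_nonneg_of_le (fun i => ?_) (fun i => ?_) hg.summable
    · split_ifs <;> positivity
    · split_ifs
      · exact le_rfl
      · positivity
  have h := (hg.mul_left ((b : ℝ) - 1)).sub (hσ.hasSum.mul_left (b : ℝ))
  rw [mul_inv_cancel₀ (by linarith)] at h
  refine h.congr_fun ?_
  intro a
  split_ifs <;> ring

/-- The sum of `r_α(k) wal_k(x)` over all `k ≥ 1` with exactly one nonzero base-`b` digit
converges (absolutely) to `s_1(x) = 1 - b ∑_{i : ξ_i ≠ 0} b^{-i}`. -/
theorem stmt8 (b α : ℕ) (hb : 2 ≤ b) (hα : 1 ≤ α) (x : ℝ) (hx0 : 0 ≤ x) (hx1 : x < 1) :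
    HasSum
      (fun k : ℕ => if (nzset b k).card = 1 then (ralpha b α k : ℂ) * wal b k x else 0)
      ((s1f b x : ℝ) : ℂ) := by
  have hb0 : b ≠ 0 := by omega
  have hζ := Complex.isPrimitiveRoot_exp b hb0
  set ζ := Complex.exp (2 * (Real.pi : ℂ) * Complex.I / (b : ℂ))
  rw [← (mul_pow_injective hb).hasSum_iff]
  · have hterm : ∀ p : ℕ × Fin (b - 1),
        ((fun k : ℕ => if (nzset b k).card = 1 then (ralpha b α k : ℂ) * wal b k x else 0) ∘
          fun p : ℕ × Fin (b - 1) => ((p.2 : ℕ) + 1) * b ^ p.1) p =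
        ((((b : ℝ) ^ (p.1 + 1))⁻¹ : ℝ) : ℂ) *
          (ζ ^ xdigit b x (p.1 + 1)) ^ ((p.2 : ℕ) + 1) := by
      rintro ⟨a, c⟩
      have hc : (c : ℕ) + 1 < b := by omega
      simp only [Function.comp_apply]
      rw [nzset_mul_pow hb (Nat.succ_pos _) hc, Finset.card_singleton, if_pos rfl,
        ralpha_mul_pow hb hα (Nat.succ_pos _) hc, wal_mul_pow hb (Nat.succ_pos _) hc]
    rw [funext hterm]
    have hsummable : Summable fun p : ℕ × Fin (b - 1) =>
        ((((b : ℝ) ^ (p.1 + 1))⁻¹ : ℝ) : ℂ) *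
          (ζ ^ xdigit b x (p.1 + 1)) ^ ((p.2 : ℕ) + 1) := by
      have h1 : Summable fun _ : Fin (b - 1) => (1 : ℝ) := (hasSum_fintype _).summable
      refine Summable.of_norm_bounded ((hasSum_inv_pow_succ hb).summable.mul_of_nonneg h1
        (fun a => by positivity) fun _ => zero_le_one) fun p => ?_
      rw [norm_mul, norm_pow, norm_pow, hζ.norm'_eq_one hb0, Complex.norm_real, one_pow, one_pow,
        Real.norm_of_nonneg (by positivity)]
    have hfib := hsummable.hasSum.prod_fiberwise fun a => hasSum_fintype _
    have hs := Complex.hasSum_ofReal.2 (hasSum_s1f hb x)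
    have hdigit : ∀ a, xdigit b x (a + 1) < b := fun a => Nat.mod_lt _ (by omega)
    have heq : ∀ a : ℕ, ∑ c : Fin (b - 1), ((((b : ℝ) ^ (a + 1))⁻¹ : ℝ) : ℂ) *
        (ζ ^ xdigit b x (a + 1)) ^ ((c : ℕ) + 1) =
        ((((b : ℝ) ^ (a + 1))⁻¹ *
          (((b : ℝ) - 1) - b * if xdigit b x (a + 1) ≠ 0 then 1 else 0) : ℝ) : ℂ) := by
      intro a
      rw [← Finset.mul_sum, sum_pow_primitiveRoot hb hζ (hdigit a)]
      split_ifs <;> push_cast <;> rfl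
    simp only [heq] at hfib
    rw [← hfib.unique hs]
    exact hsummable.hasSum
  · intro k hk
    refine if_neg fun h => hk ?_
    obtain ⟨a, ha⟩ := Finset.card_eq_one.1 h
    obtain ⟨hpos, hk'⟩ := eq_mul_pow_of_nzset_eq hb ha
    have hlt : ndigit b k a < b := Nat.mod_lt _ (by omega)
    refine ⟨(a, ⟨ndigit b k a - 1, by omega⟩), ?_⟩
    simp only [Nat.sub_add_cancel hpos]
    exact hk'.symm
end
end
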